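/- Let U ⊆ ℚ_p^n be a nonempty open set, let f, g : U → ℚ_p be nonzero p-adic analytic functions such that there is no constant c ∈ ℚ_p with f(x) = c·g(x) for all x ∈ U, and let D = {x ∈ U : f(x)·g(x) = 0}. Then the following are equivalent: (i) there exists a nonempty compact open set W ⊆ U such that the set {σ ∈ ℝ : σ ≤ 0 and x ↦ |f(x)/g(x)|_p^σ is integrable on W ∖ D} is bounded below; (ii) there exist a compact set A ⊆ U and a sequence (a_k)_{k∈ℕ} with a_k ∈ A ∖ D for all k such that |f(a_k)/g(a_k)|_p → 0 as k → ∞. -/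

import Mathlib

open MeasureTheory

section Auxiliary

open Filter Topology

section Division
variable {K E : Type*} [NontriviallyNormedField K] [NormedAddCommGroup E] [NormedSpace K E]

theorem ContinuousMultilinearMap.sub_eq_sum_curryMid {k : ℕ}
    (p : E [×(k + 1)]→L[K] K) (P : E →L[K] E) (l : E →L[K] K) (e : E)
    (hP : ∀ x, x = P x + l x • e) (x : E) :
    p (fun _ => x) - p (fun _ => P x) = l x * ∑ j : Fin (k + 1),
      p (j.insertNth e (fun i : Fin k => if i.castSucc < j then P x else x)) := by
  set a : ℕ → K := fun j => p (fun i : Fin (k + 1) => if (i : ℕ) < j then P x else x) with ha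
  have h0 : p (fun _ => x) = a 0 := by simp [ha]
  have h1 : p (fun _ => P x) = a (k + 1) := by
    simp only [ha]
    congr 1
    funext i
    rw [if_pos i.is_lt]
  rw [h0, h1, ← neg_sub, ← Finset.sum_range_sub, ← Finset.sum_neg_distrib, Finset.mul_sum,
    Finset.sum_range]
  refine Finset.sum_congr rfl fun j _ => ?_
  set m : Fin (k + 1) → E := fun i => if (i : ℕ) < j then P x else x with hm
  have e1 : (fun i : Fin (k + 1) => if (i : ℕ) < (j : ℕ) then P x else x)
      = Function.update m j x := by
    funext i
    by_cases h : i = j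
    · subst h; simp
    · simp [h, hm]
  have e2 : (fun i : Fin (k + 1) => if (i : ℕ) < (j : ℕ) + 1 then P x else x)
      = Function.update m j (P x) := by
    funext i
    by_cases h : i = j
    · subst h; simp
    · have : (i : ℕ) < (j : ℕ) + 1 ↔ (i : ℕ) < j := by
        have : (i : ℕ) ≠ j := fun h' => h (Fin.ext h')
        omega
      simp [h, hm, this]
  have e3 : (j.insertNth e (fun i : Fin k => if i.castSucc < j then P x else x) : Fin (k + 1) → E)
      = Function.update m j e := by
    rw [Fin.insertNth_eq_iff]
    refine ⟨by simp, ?_⟩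
    funext i
    have : ((j.succAbove i : Fin (k + 1)) : ℕ) < j ↔ i.castSucc < j := by
      rw [← Fin.lt_def, Fin.succAbove_lt_iff_castSucc_lt]
    rw [Fin.removeNth, Function.update_of_ne (Fin.succAbove_ne j i)]
    simp only [hm, this]
  simp only [ha]
  rw [e1, e2, e3, neg_sub, ← p.map_update_sub, ← smul_eq_mul, ← p.map_update_smul]
  congr 2
  rw [sub_eq_iff_eq_add']
  exact hP x

theorem AnalyticAt.exists_eq_add_mul [CompleteSpace K] {f : E → K} (hf : AnalyticAt K f 0)
    (P : E →L[K] E) (l : E →L[K] K) (e : E) (hP : ∀ x, x = P x + l x • e) :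
    ∃ q : E → K, AnalyticAt K q 0 ∧ ∀ᶠ x in 𝓝 0, f x = f (P x) + l x * q x := by
  obtain ⟨p, hp⟩ := hf
  obtain ⟨A, R, hA, hR, hAR⟩ := p.le_mul_pow_of_radius_pos hp.radius_pos
  let Q : FormalMultilinearSeries K E K := fun k => ∑ j : Fin (k + 1),
    ((p (k + 1)).curryMid j e).compContinuousLinearMap
      (fun i : Fin k => if i.castSucc < j then P else ContinuousLinearMap.id K E)
  have hQ : ∀ k x, p (k + 1) (fun _ => x) - p (k + 1) (fun _ => P x) = l x * Q k (fun _ => x) := by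
    intro k x
    rw [ContinuousMultilinearMap.sub_eq_sum_curryMid _ P l e hP]
    congr 1
    simp only [Q, sum_apply,
      ContinuousMultilinearMap.compContinuousLinearMap_apply,
      ContinuousMultilinearMap.curryMid_apply]
    refine Finset.sum_congr rfl fun j _ => ?_
    congr 2
    funext i
    split_ifs <;> simp
  set C : ℝ := max ‖P‖ 1 with hC
  have hC0 : 0 ≤ C := le_trans zero_le_one (le_max_right _ _)
  have hnorm : ∀ k, ‖Q k‖ ≤ (A * R * ‖e‖) * (2 * R * C) ^ k := by
    intro k
    have hterm : ∀ j : Fin (k + 1), ‖((p (k + 1)).curryMid j e).compContinuousLinearMap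
      (fun i : Fin k => if i.castSucc < j then P else ContinuousLinearMap.id K E)‖
        ≤ A * R ^ (k + 1) * ‖e‖ * C ^ k := by
      intro j
      refine (ContinuousMultilinearMap.norm_compContinuousLinearMap_le _ _).trans ?_
      have h1 : ‖(p (k + 1)).curryMid j e‖ ≤ A * R ^ (k + 1) * ‖e‖ := by
        refine (ContinuousLinearMap.le_opNorm _ _).trans ?_
        gcongr
        refine le_trans (le_of_eq ?_) (hAR (k + 1))
        exact (ContinuousMultilinearMap.curryMidEquiv (𝕜 := K) (Ei := fun _ => E) (G := K) j).norm_map (p (k+1))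
      have h2 : ∏ i : Fin k, ‖if i.castSucc < j then P else ContinuousLinearMap.id K E‖ ≤ C ^ k := by
        calc _ ≤ ∏ i : Fin k, C := by
              refine Finset.prod_le_prod (fun _ _ => norm_nonneg _) fun i _ => ?_
              split_ifs
              · exact le_max_left _ _
              · exact ContinuousLinearMap.norm_id_le.trans (le_max_right _ _)
          _ = C ^ k := by simp
      have : 0 ≤ ∏ i : Fin k, ‖if i.castSucc < j then P else ContinuousLinearMap.id K E‖ :=
        Finset.prod_nonneg fun _ _ => norm_nonneg _
      exact mul_le_mul h1 h2 this ((norm_nonneg _).trans h1)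
    calc ‖Q k‖ ≤ ∑ j : Fin (k + 1), A * R ^ (k + 1) * ‖e‖ * C ^ k :=
          (norm_sum_le _ _).trans (Finset.sum_le_sum fun j _ => hterm j)
      _ = ((k + 1 : ℕ) : ℝ) * ((A * R * ‖e‖) * (R * C) ^ k) := by
          rw [Finset.sum_const, Finset.card_univ, Fintype.card_fin, nsmul_eq_mul]; ring
      _ ≤ (2 ^ k : ℝ) * ((A * R * ‖e‖) * (R * C) ^ k) := by
          gcongr
          exact_mod_cast Nat.lt_two_pow_self
      _ = _ := by rw [mul_assoc 2, mul_pow 2]; ring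
  have hrad : 0 < Q.radius := by
    have hpos : (0 : ℝ) < 2 * R * C := by
      have : (0:ℝ) < C := lt_of_lt_of_le one_pos (le_max_right _ _)
      positivity
    refine lt_of_lt_of_le ?_ (Q.le_radius_of_bound (r := ⟨(2 * R * C)⁻¹, by positivity⟩)
      (A * R * ‖e‖) ?_)
    · exact ENNReal.coe_pos.2 (NNReal.coe_pos.1 (inv_pos.2 hpos))
    · intro k
      have := hnorm k
      calc ‖Q k‖ * ((2 * R * C)⁻¹) ^ k ≤ (A * R * ‖e‖) * (2 * R * C) ^ k * ((2 * R * C)⁻¹) ^ k := by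
            gcongr
        _ = _ := by rw [mul_assoc, ← mul_pow, mul_inv_cancel₀ hpos.ne']; simp
  have hQs := Q.hasFPowerSeriesOnBall hrad
  refine ⟨Q.sum, hQs.analyticAt, ?_⟩
  have hPt : Tendsto P (𝓝 0) (𝓝 0) := by simpa using P.continuous.tendsto 0
  filter_upwards [hp.eventually_hasSum, hPt.eventually hp.eventually_hasSum,
    hQs.hasFPowerSeriesAt.eventually_hasSum] with x h1 h2 h3
  simp only [zero_add] at h1 h2 h3
  have h4 := (hasSum_nat_add_iff' 1).2 (h1.sub h2)
  simp only [hQ] at h4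
  have h5 := h3.mul_left (l x)
  have h6 := h4.unique h5
  have h7 : p 0 (fun _ => x) = p 0 (fun _ => P x) := by
    congr 1; funext i; exact i.elim0
  simp only [Finset.range_one, Finset.sum_singleton, h7, sub_self, sub_zero] at h6
  rw [← h6]; ring
end Division

section Domain
variable {K E : Type*} [NontriviallyNormedField K] [NormedAddCommGroup E] [NormedSpace K E]

theorem ContinuousMultilinearMap.exists_polynomial_eval_line {k : ℕ} (p : E [×k]→L[K] K) (v w : E) :
    ∃ Q : Polynomial K, ∀ r : K, Q.eval r = p (fun _ => v + r • w) := by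
  classical
  refine ⟨∑ s : Finset (Fin k), Polynomial.C (p (s.piecewise (fun _ => w) (fun _ => v))) *
    Polynomial.X ^ s.card, fun r => ?_⟩
  have h := p.toMultilinearMap.map_add_univ (fun _ => r • w) (fun _ => v)
  have h' : p (fun _ => v + r • w) = p.toMultilinearMap ((fun _ => r • w) + fun _ => v) := by
    change p _ = p _
    congr 1; funext i; simp [add_comm]
  rw [h', h, Polynomial.eval_finsetSum]
  refine Finset.sum_congr rfl fun s _ => ?_
  have := p.toMultilinearMap.map_piecewise_smul (fun _ => r) (s.piecewise (fun _ => w) (fun _ => v)) s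
  have e : s.piecewise (fun i => r • s.piecewise (fun _ => w) (fun _ => v) i)
      (s.piecewise (fun _ => w) (fun _ => v)) = s.piecewise (fun _ : Fin k => r • w) (fun _ => v) := by
    funext i
    by_cases hi : i ∈ s <;> simp [hi]
  rw [e] at this
  rw [this, Finset.prod_const, Polynomial.eval_mul, Polynomial.eval_C, Polynomial.eval_pow,
    Polynomial.eval_X, smul_eq_mul, mul_comm]
  rfl

theorem HasFPowerSeriesAt.apply_eq_zero_of_eventually_line {f : E → K}
    {p : FormalMultilinearSeries K E K}
    (hp : HasFPowerSeriesAt f p 0) {v : E} (h : ∀ᶠ s : K in 𝓝 0, f (s • v) = 0) (k : ℕ) :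
    p k (fun _ => v) = 0 := by
  let u := ContinuousLinearMap.toSpanSingleton K v
  have h1 : HasFPowerSeriesAt (f ∘ u) (p.compContinuousLinearMap u) 0 := by
    apply HasFPowerSeriesAt.compContinuousLinearMap
    simpa [u] using hp
  have h2 : p.compContinuousLinearMap u = 0 := h1.eq_zero_of_eventually (by simpa [u] using! h)
  have h3 : p.compContinuousLinearMap u k (fun _ => 1) = 0 := by rw [h2]; rfl
  rw [FormalMultilinearSeries.compContinuousLinearMap_apply] at h3
  simpa only [u, Function.comp_def, ContinuousLinearMap.toSpanSingleton_apply, one_smul] using h3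

theorem AnalyticAt.eventually_eq_zero_or_of_mul {f g : E → K} (hf : AnalyticAt K f 0)
    (hg : AnalyticAt K g 0) (hfg : ∀ᶠ x in 𝓝 0, f x * g x = 0) :
    (∀ᶠ x in 𝓝 0, f x = 0) ∨ ∀ᶠ x in 𝓝 0, g x = 0 := by
  obtain ⟨p, hp⟩ := id hf
  obtain ⟨q, hq⟩ := id hg
  have nz : ∀ {h : E → K} {r : FormalMultilinearSeries K E K}, HasFPowerSeriesAt h r 0 →
      (¬ ∀ᶠ x in 𝓝 0, h x = 0) → ∃ v k, r k (fun _ => v) ≠ 0 := by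
    intro h r hr hne
    by_contra! hcon
    refine hne ?_
    filter_upwards [hr.eventually_hasSum] with x hx
    simp only [hcon, zero_add] at hx
    exact hx.unique hasSum_zero
  have line : ∀ v : E, (∀ k, p k (fun _ => v) = 0) ∨ (∀ k, q k (fun _ => v) = 0) := by
    intro v
    have ht : Tendsto (fun s : K => s • v) (𝓝 0) (𝓝 0) := by
      have : Continuous fun s : K => s • v := by fun_prop
      simpa using this.tendsto 0
    have hl : AnalyticAt K (fun s : K => s • v) 0 := by fun_prop
    have hf1 : AnalyticAt K (fun s : K => f (s • v)) 0 :=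
      AnalyticAt.fun_comp (by simpa using hf) hl
    rcases hf1.eventually_eq_zero_or_eventually_ne_zero with h | h
    · exact Or.inl (hp.apply_eq_zero_of_eventually_line h)
    · have hg1 : AnalyticAt K (fun s : K => g (s • v)) 0 :=
        AnalyticAt.fun_comp (by simpa using hg) hl
      rcases hg1.eventually_eq_zero_or_eventually_ne_zero with h' | h'
      · exact Or.inr (hq.apply_eq_zero_of_eventually_line h')
      · exfalso
        have h3 := (ht.eventually hfg).filter_mono (nhdsWithin_le_nhds (s := {0}ᶜ))
        obtain ⟨s, h1, h2, h3⟩ := (h.and (h'.and h3)).exists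
        exact (mul_ne_zero h1 h2) h3
  by_contra hcon
  rw [not_or] at hcon
  obtain ⟨v, k, hv⟩ := nz hp hcon.1
  obtain ⟨w, l, hw⟩ := nz hq hcon.2
  obtain ⟨P, hP⟩ := (p k).exists_polynomial_eval_line v (w - v)
  obtain ⟨Q, hQ⟩ := (q l).exists_polynomial_eval_line v (w - v)
  have hPQ : P * Q = 0 := by
    refine Polynomial.funext fun r => ?_
    rw [Polynomial.eval_mul, hP, hQ, Polynomial.eval_zero]
    rcases line (v + r • (w - v)) with h | h <;> simp [h]
  rcases mul_eq_zero.1 hPQ with h | h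
  · exact hv (by simpa [h] using (hP 0).symm)
  · exact hw (by simpa [h] using (hQ 1).symm)
end Domain

section FunProp
variable {K E F G : Type*} [NontriviallyNormedField K] [NormedAddCommGroup E] [NormedSpace K E]
  [NormedAddCommGroup F] [NormedSpace K F] [NormedAddCommGroup G] [NormedSpace K G]

@[fun_prop]
theorem AnalyticAt.fst_comp {f : G → E × F} {x : G} (hf : AnalyticAt K f x) :
    AnalyticAt K (fun y => (f y).1) x :=
  AnalyticAt.fun_comp (g := Prod.fst) analyticAt_fst hf

@[fun_prop]
theorem AnalyticAt.snd_comp {f : G → E × F} {x : G} (hf : AnalyticAt K f x) :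
    AnalyticAt K (fun y => (f y).2) x :=
  AnalyticAt.fun_comp (g := Prod.snd) analyticAt_snd hf

theorem AnalyticAt.comp_zero {g : F → G} {f : E → F} (hg : AnalyticAt K g 0)
    (hf : AnalyticAt K f 0) (h0 : f 0 = 0) : AnalyticAt K (fun x => g (f x)) 0 :=
  AnalyticAt.fun_comp (by rwa [h0]) hf

end FunProp

section Tschirnhaus
variable {K E : Type*} [NontriviallyNormedField K] [NormedAddCommGroup E] [NormedSpace K E]

theorem AnalyticAt.exists_eq_sum_mul_pow_add [CompleteSpace K] {f : E × K → K}
    (hf : AnalyticAt K f 0) (d : ℕ) :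
    ∃ (c : ℕ → E → K) (u : E × K → K), (∀ j, AnalyticAt K (c j) 0) ∧ AnalyticAt K u 0 ∧
      ∀ᶠ x : E × K in 𝓝 0, f x = ∑ j ∈ Finset.range d, c j x.1 * x.2 ^ j + x.2 ^ d * u x := by
  induction d with
  | zero => exact ⟨fun _ _ => 0, f, fun _ => analyticAt_const, hf, by simp⟩
  | succ d ih =>
    obtain ⟨c, u, hc, hu, h⟩ := ih
    obtain ⟨q, hq, h'⟩ := hu.exists_eq_add_mul
      ((ContinuousLinearMap.inl K E K).comp (ContinuousLinearMap.fst K E K))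
      (ContinuousLinearMap.snd K E K) (0, 1) (by rintro ⟨z, t⟩; simp)
    refine ⟨fun j => if j < d then c j else fun z => u (z, 0), q, fun j => ?_, hq, ?_⟩
    · dsimp only
      split_ifs
      · exact hc j
      · exact hu.comp_zero (by fun_prop) rfl
    · filter_upwards [h, h'] with x hx hx'
      simp only [ContinuousLinearMap.comp_apply, ContinuousLinearMap.coe_fst',
        ContinuousLinearMap.coe_snd', ContinuousLinearMap.inl_apply] at hx'
      have e : ∀ j ∈ Finset.range d, (if j < d then c j else fun z => u (z, 0)) x.1 * x.2 ^ j =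
          c j x.1 * x.2 ^ j := fun j hj => by rw [if_pos (Finset.mem_range.1 hj)]
      rw [hx, hx', Finset.sum_range_succ, Finset.sum_congr rfl e]
      simp only [lt_irrefl, if_false]
      ring

theorem eq_of_eventually_sum_mul_pow_add_eq {d : ℕ} {a b : ℕ → K} {u v : K → K}
    (hu : ContinuousAt u 0) (hv : ContinuousAt v 0)
    (h : ∀ᶠ t in 𝓝 (0 : K), ∑ j ∈ Finset.range d, a j * t ^ j + t ^ d * u t =
      ∑ j ∈ Finset.range d, b j * t ^ j + t ^ d * v t) :
    (∀ j < d, a j = b j) ∧ u 0 = v 0 := by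
  induction d generalizing a b with
  | zero => exact ⟨by simp, by simpa using h.self_of_nhds⟩
  | succ d ih =>
    have h0 : a 0 = b 0 := by
      have := h.self_of_nhds
      simpa [Finset.sum_range_succ'] using this
    have hstep : ∀ᶠ t in 𝓝[≠] (0 : K),
        ∑ j ∈ Finset.range d, a (j + 1) * t ^ j + t ^ d * u t =
        ∑ j ∈ Finset.range d, b (j + 1) * t ^ j + t ^ d * v t := by
      filter_upwards [h.filter_mono nhdsWithin_le_nhds, self_mem_nhdsWithin] with t ht ht0
      rw [Finset.sum_range_succ', Finset.sum_range_succ', h0] at ht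
      refine mul_left_cancel₀ (a := t) ht0 ?_
      rw [mul_add, mul_add, Finset.mul_sum, Finset.mul_sum]
      have e : ∀ c : ℕ → K, ∑ j ∈ Finset.range d, t * (c (j + 1) * t ^ j) =
          ∑ j ∈ Finset.range d, c (j + 1) * t ^ (j + 1) := fun c =>
        Finset.sum_congr rfl fun j _ => by ring
      rw [e, e]
      linear_combination ht
    have h1 : ∀ᶠ t in 𝓝 (0 : K),
        ∑ j ∈ Finset.range d, a (j + 1) * t ^ j + t ^ d * u t =
        ∑ j ∈ Finset.range d, b (j + 1) * t ^ j + t ^ d * v t := by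
      have hz := tendsto_nhds_unique_of_eventuallyEq
        (l := 𝓝[≠] (0 : K)) (a := ∑ j ∈ Finset.range d, a (j + 1) * (0:K) ^ j + 0 ^ d * u 0)
        (b := ∑ j ∈ Finset.range d, b (j + 1) * (0:K) ^ j + 0 ^ d * v 0) ?_ ?_ hstep
      · rw [← nhdsNE_sup_pure, eventually_sup]
        exact ⟨hstep, by simpa using hz⟩
      · have : ContinuousAt (fun t => ∑ j ∈ Finset.range d, a (j + 1) * t ^ j + t ^ d * u t) 0 := by
          fun_prop
        exact this.tendsto.mono_left nhdsWithin_le_nhds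
      · have : ContinuousAt (fun t => ∑ j ∈ Finset.range d, b (j + 1) * t ^ j + t ^ d * v t) 0 := by
          fun_prop
        exact this.tendsto.mono_left nhdsWithin_le_nhds
    obtain ⟨h2, h3⟩ := ih (a := fun j => a (j + 1)) (b := fun j => b (j + 1)) h1
    refine ⟨fun j hj => ?_, h3⟩
    cases j with
    | zero => exact h0
    | succ j => exact h2 j (by omega)

theorem AnalyticAt.exists_implicit [CompleteSpace K] [CompleteSpace E] {C : E × K → K}
    (hC : AnalyticAt K C 0) (h0 : C 0 = 0) {a : K} (ha : a ≠ 0)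
    (hd : HasDerivAt (fun s => C (0, s)) a 0) :
    ∃ φ : E → K, AnalyticAt K φ 0 ∧ φ 0 = 0 ∧ ∀ᶠ z in 𝓝 0, C (z, φ z) = 0 := by
  set L := fderiv K C 0 with hL
  have hCd : HasStrictFDerivAt C L 0 := hC.hasStrictFDerivAt
  have hLa : ∀ s, L (0, s) = s * a := by
    have h1 : HasFDerivAt (fun s : K => ((0 : E), s)) (ContinuousLinearMap.inr K E K) 0 :=
      (ContinuousLinearMap.inr K E K).hasFDerivAt
    have h2 : HasFDerivAt (fun s : K => C (0, s)) (L.comp (ContinuousLinearMap.inr K E K)) 0 :=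
      HasFDerivAt.comp (0 : K) (g := C) (f := fun s : K => ((0 : E), s)) hCd.hasFDerivAt h1
    intro s
    have h3 := h2.hasDerivAt.unique hd
    simp only [ContinuousLinearMap.comp_apply, ContinuousLinearMap.inr_apply] at h3
    rw [← h3, ← smul_eq_mul, ← map_smul]
    simp
  have hLz : ∀ z s, L (z, s) = L (z, 0) + s * a := by
    intro z s
    rw [← hLa, ← map_add]; simp
  let T : (E × K) →L[K] (E × K) := (ContinuousLinearMap.fst K E K).prod L
  let S : (E × K) →L[K] (E × K) := (ContinuousLinearMap.fst K E K).prod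
    (a⁻¹ • (ContinuousLinearMap.snd K E K - L.comp ((ContinuousLinearMap.inl K E K).comp
      (ContinuousLinearMap.fst K E K))))
  have hST : Function.LeftInverse S T := by
    rintro ⟨z, s⟩
    simp only [S, T, ContinuousLinearMap.prod_apply, ContinuousLinearMap.coe_fst',
      smul_apply, sub_apply,
      ContinuousLinearMap.coe_snd', ContinuousLinearMap.comp_apply, ContinuousLinearMap.inl_apply]
    rw [hLz z s]
    simp [mul_comm s a, ha]
  have hTS : Function.RightInverse S T := by
    rintro ⟨z, s⟩
    simp only [S, T, ContinuousLinearMap.prod_apply, ContinuousLinearMap.coe_fst',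
      smul_apply, sub_apply,
      ContinuousLinearMap.coe_snd', ContinuousLinearMap.comp_apply, ContinuousLinearMap.inl_apply]
    rw [hLz]
    simp only [smul_eq_mul]
    field_simp
    simp
  let T' : (E × K) ≃L[K] (E × K) := ContinuousLinearEquiv.equivOfInverse T S hST hTS
  let Φ : E × K → E × K := fun x => (x.1, C x)
  have hΦ : HasStrictFDerivAt Φ (T' : (E × K) →L[K] (E × K)) 0 :=
    hasStrictFDerivAt_fst.prodMk hCd
  have hΦa : AnalyticAt K Φ 0 := by fun_prop
  let G := hΦ.toOpenPartialHomeomorph Φ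
  have hG : ∀ x, G x = Φ x := fun x => rfl
  have hmem : (0 : E × K) ∈ G.source := hΦ.mem_toOpenPartialHomeomorph_source
  have hΦ0 : Φ 0 = 0 := by simp [Φ, h0]
  have hmemt : (0 : E × K) ∈ G.target := by
    have := G.map_source hmem
    rwa [hG, hΦ0] at this
  have hGs : G.symm 0 = 0 := by
    have := G.left_inv hmem
    rwa [hG, hΦ0] at this
  have hsa : AnalyticAt K G.symm 0 := by
    have := G.analyticAt_symm' (i := T') hmem hΦa hΦ.hasFDerivAt.fderiv
    rwa [hG, hΦ0] at this
  refine ⟨fun z => (G.symm (z, 0)).2, ?_, ?_, ?_⟩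
  · have h1 : AnalyticAt K (fun z : E => G.symm (z, 0)) 0 :=
      hsa.comp_zero (by fun_prop) rfl
    fun_prop
  · have : ((0 : E), (0 : K)) = 0 := rfl
    simp [this, hGs]
  · have ht : Tendsto (fun z : E => (z, (0 : K))) (𝓝 0) (𝓝 0) := by
      have : Continuous fun z : E => (z, (0 : K)) := by fun_prop
      exact this.tendsto 0
    filter_upwards [ht.eventually (G.open_target.mem_nhds hmemt)] with z hz
    have h1 := G.right_inv hz
    rw [hG] at h1
    have h2 : (G.symm (z, 0)).1 = z := congrArg Prod.fst h1
    have h3 : C (G.symm (z, 0)) = 0 := congrArg Prod.snd h1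
    have h4 : (z, (G.symm (z, 0)).2) = G.symm (z, 0) := Prod.ext h2.symm rfl
    rw [h4, h3]
end Tschirnhaus

section Tschirnhaus
variable {K E : Type*} [NontriviallyNormedField K] [NormedAddCommGroup E] [NormedSpace K E]

theorem AnalyticAt.exists_tschirnhaus [CharZero K] [CompleteSpace K] [CompleteSpace E]
    {h : E × K → K} (hh : AnalyticAt K h 0) {m : ℕ}
    (hord : analyticOrderAt (fun t : K => h (0, t)) 0 = (m + 1 : ℕ)) :
    ∃ (φ : E → K) (c : ℕ → E → K) (u : E × K → K), AnalyticAt K φ 0 ∧ φ 0 = 0 ∧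
      (∀ j, AnalyticAt K (c j) 0) ∧ AnalyticAt K u 0 ∧ u 0 ≠ 0 ∧
      ∀ᶠ x : E × K in 𝓝 0, h (x.1, φ x.1 + x.2) =
        ∑ j ∈ Finset.range m, c j x.1 * x.2 ^ j + x.2 ^ (m + 1) * u x := by
  have hG : AnalyticAt K (fun x : (E × K) × K => h (x.1.1, x.1.2 + x.2)) 0 :=
    hh.comp_zero (by fun_prop) (by simp)
  obtain ⟨C, U, hC, hU, hGe⟩ := hG.exists_eq_sum_mul_pow_add (m + 1)
  set h0 : K → K := fun t => h (0, t) with hh0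
  have h0a : AnalyticAt K h0 0 := hh.comp_zero (by fun_prop) rfl
  have hemb : Tendsto (fun x : K × K => (((0 : E), x.1), x.2)) (𝓝 0) (𝓝 0) := by
    have : Continuous (fun x : K × K => (((0 : E), x.1), x.2)) := by fun_prop
    exact this.tendsto 0
  have hemb1 : Tendsto (fun s : K => (((0 : E), s), (0 : K))) (𝓝 0) (𝓝 0) := by
    have : Continuous (fun s : K => (((0 : E), s), (0 : K))) := by fun_prop
    exact this.tendsto 0
  have hcoef : ∀ᶠ s in 𝓝 (0 : K), ∀ j < m + 1,
      C j (0, s) = iteratedDeriv j h0 s / (j.factorial : K) := by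
    have h1 : ∀ᶠ s in 𝓝 (0 : K), ∀ᶠ t in 𝓝 (0 : K), h0 (s + t) =
        ∑ j ∈ Finset.range (m + 1), C j (0, s) * t ^ j + t ^ (m + 1) * U ((0, s), t) :=
      (hemb.eventually hGe).curry_nhds
    filter_upwards [h1, h0a.eventually_analyticAt, hemb1.eventually hU.eventually_analyticAt]
      with s hs hsa hsU
    have hψ : AnalyticAt K (fun t => h0 (s + t)) 0 := AnalyticAt.fun_comp (by simpa using hsa) (by fun_prop)
    obtain ⟨F, hF, hFe⟩ := hψ.exists_eventuallyEq_sum_add_pow_mul (m + 1)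
    have hUc : ContinuousAt (fun t => U ((0, s), t)) 0 :=
      ContinuousAt.comp' (g := U) hsU.continuousAt (by fun_prop)
    obtain ⟨h2, -⟩ := eq_of_eventually_sum_mul_pow_add_eq (d := m + 1) (a := fun j => C j (0, s))
      (b := fun j => iteratedDeriv j h0 s / (j.factorial : K)) hUc hF.continuousAt (by
        filter_upwards [hs, hFe] with t ht ht'
        rw [← ht, ht', smul_eq_mul]
        congr 1
        refine Finset.sum_congr rfl fun j _ => ?_
        rw [iteratedDeriv_comp_const_add, smul_eq_mul]
        simp only [add_zero]
        ring)
    exact h2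
  obtain ⟨hz, hnz⟩ := (analyticOrderAt_eq_nat_iff_iteratedDeriv_eq_zero h0a).1 hord
  have hC0 : ∀ j < m + 1, C j 0 = 0 := by
    intro j hj
    have := hcoef.self_of_nhds j hj
    rw [hz j hj, zero_div] at this
    exact this
  have hU0 : U 0 ≠ 0 := by
    obtain ⟨v, hv, hv0, hve⟩ := h0a.analyticOrderAt_eq_natCast.1 hord
    have hUc : ContinuousAt (fun t => U (0, t)) 0 :=
      ContinuousAt.comp' (g := U) hU.continuousAt (by fun_prop)
    have hemb2 : Tendsto (fun t : K => ((0 : E × K), t)) (𝓝 0) (𝓝 0) := by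
      have : Continuous (fun t : K => ((0 : E × K), t)) := by fun_prop
      exact this.tendsto 0
    obtain ⟨-, h2⟩ := eq_of_eventually_sum_mul_pow_add_eq (d := m + 1) (a := fun j => C j 0)
      (b := fun _ => 0) hUc hv.continuousAt (by
        filter_upwards [hve, hemb2.eventually hGe] with t ht ht'
        simp only [Prod.fst_zero, Prod.snd_zero, zero_add] at ht'
        rw [← ht']
        simpa [hh0] using ht)
    have h3 : ((0 : E × K), (0 : K)) = 0 := rfl
    rw [h3] at h2
    rwa [h2]
  have hCm : AnalyticAt K (fun s => C m (0, s)) 0 := (hC m).comp_zero (by fun_prop) rfl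
  have hder : HasDerivAt (fun s => C m (0, s)) (iteratedDeriv (m + 1) h0 0 / (m.factorial : K)) 0 := by
    have h1 : (fun s => C m (0, s)) =ᶠ[𝓝 0] fun s => iteratedDeriv m h0 s / (m.factorial : K) := by
      filter_upwards [hcoef] with s hs using hs m (by omega)
    have h2 := h1.deriv_eq
    rw [deriv_div_const, ← iteratedDeriv_succ] at h2
    rw [← h2]
    exact hCm.differentiableAt.hasDerivAt
  obtain ⟨φ, hφ, hφ0, hφe⟩ := (hC m).exists_implicit (hC0 m (by omega))
    (div_ne_zero hnz (by exact_mod_cast m.factorial_ne_zero)) hder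
  have hpair : AnalyticAt K (fun z : E => (z, φ z)) 0 := by fun_prop
  refine ⟨φ, fun j z => C j (z, φ z), fun x => U ((x.1, φ x.1), x.2), hφ, hφ0,
    fun j => (hC j).comp_zero hpair (by simp [hφ0]), ?_, ?_, ?_⟩
  · refine hU.comp_zero ?_ (by simp [hφ0])
    have : AnalyticAt K (fun x : E × K => φ x.1) 0 := hφ.comp_zero (by fun_prop) rfl
    fun_prop
  · change U ((0, φ 0), 0) ≠ 0
    rw [hφ0]
    exact hU0
  · have ht : Tendsto (fun x : E × K => ((x.1, φ x.1), x.2)) (𝓝 0) (𝓝 0) := by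
      have h1 : AnalyticAt K (fun x : E × K => φ x.1) 0 := hφ.comp_zero (by fun_prop) rfl
      have h2 : AnalyticAt K (fun x : E × K => ((x.1, φ x.1), x.2)) 0 := by fun_prop
      have h3 := h2.continuousAt.tendsto
      change Tendsto _ _ (𝓝 (((0 : E), φ 0), (0 : K))) at h3
      rwa [hφ0] at h3
    have ht1 : Tendsto (fun x : E × K => x.1) (𝓝 0) (𝓝 0) := continuous_fst.tendsto 0
    filter_upwards [ht.eventually hGe, ht1.eventually hφe] with x hx hx'
    rw [hx, Finset.sum_range_succ, hx']
    ring
end Tschirnhaus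

/-- Any property holding near `0` holds at points with prescribed vanishing coordinates. -/
theorem exists_of_eventually_nhds_zero {K ι : Type*} [NontriviallyNormedField K]
    (s : Set ι) {Q : (ι → K) → Prop} (h : ∀ᶠ z in 𝓝 0, Q z) :
    ∃ z, Q z ∧ ∀ i, z i = 0 ↔ i ∈ s := by
  classical
  have ht : Tendsto (fun (r : K) (i : ι) => if i ∈ s then 0 else r) (𝓝 0) (𝓝 0) := by
    have : Continuous (fun (r : K) (i : ι) => if i ∈ s then 0 else r) := by
      refine continuous_pi fun i => ?_
      split_ifs <;> fun_prop
    have h := this.tendsto 0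
    have e : (fun i : ι => if i ∈ s then 0 else (0 : K)) = 0 := by funext i; simp
    rwa [e] at h
  obtain ⟨r, hr, hr0⟩ := (((ht.eventually h).filter_mono nhdsWithin_le_nhds).and
    (self_mem_nhdsWithin : {0}ᶜ ∈ 𝓝[≠] (0 : K))).exists
  refine ⟨_, hr, fun i => ?_⟩
  by_cases hi : i ∈ s <;> simp [hi]
  exact hr0

section NormalForm
variable {K ι : Type*} [NontriviallyNormedField K] [Fintype ι]

/-- The monomial `∏ i, z i ^ α i`. -/
def coordMonomial (α : ι → ℕ) (z : ι → K) : K := ∏ i, z i ^ α i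

theorem coordMonomial_zero (z : ι → K) : coordMonomial 0 z = 1 := by simp [coordMonomial]

theorem coordMonomial_add (α β : ι → ℕ) (z : ι → K) :
    coordMonomial (α + β) z = coordMonomial α z * coordMonomial β z := by
  simp [coordMonomial, pow_add, Finset.prod_mul_distrib]

theorem coordMonomial_smul (k : ℕ) (α : ι → ℕ) (z : ι → K) :
    coordMonomial (k • α) z = coordMonomial α z ^ k := by
  simp only [coordMonomial, ← Finset.prod_pow, Pi.smul_apply, smul_eq_mul]
  exact Finset.prod_congr rfl fun i _ => by rw [mul_comm, pow_mul]

theorem coordMonomial_single [DecidableEq ι] (i : ι) (z : ι → K) :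
    coordMonomial (Pi.single i 1) z = z i := by
  rw [coordMonomial, Finset.prod_eq_single i]
  · simp
  · intro j _ hj; simp [hj]
  · simp

theorem coordMonomial_eq_mul [DecidableEq ι] {α : ι → ℕ} {i : ι} (h : α i ≠ 0) (z : ι → K) :
    coordMonomial α z = z i * coordMonomial (α - Pi.single i 1) z := by
  have : α = Pi.single i 1 + (α - Pi.single i 1) := by
    refine (add_tsub_cancel_of_le ?_).symm
    intro j
    by_cases hj : j = i
    · subst hj; simp; omega
    · simp [hj]
  conv_lhs => rw [this]
  rw [coordMonomial_add, coordMonomial_single]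

theorem coordMonomial_ne_zero {α : ι → ℕ} {z : ι → K} (h : ∀ i, α i ≠ 0 → z i ≠ 0) :
    coordMonomial α z ≠ 0 := by
  refine Finset.prod_ne_zero_iff.2 fun i _ => ?_
  by_cases hi : α i = 0
  · simp [hi]
  · exact pow_ne_zero _ (h i hi)

theorem coordMonomial_eq_zero {α : ι → ℕ} {z : ι → K} {i : ι} (hα : α i ≠ 0) (hz : z i = 0) :
    coordMonomial α z = 0 :=
  Finset.prod_eq_zero (Finset.mem_univ i) (by rw [hz, zero_pow hα])

@[fun_prop]
theorem analyticAt_apply (i : ι) (x : ι → K) : AnalyticAt K (fun z : ι → K => z i) x :=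
  (ContinuousLinearMap.proj (R := K) (φ := fun _ : ι => K) i).analyticAt x

theorem analyticAt_coordMonomial (α : ι → ℕ) (z : ι → K) :
    AnalyticAt K (coordMonomial α : (ι → K) → K) z :=
  Finset.analyticAt_fun_prod _ fun i _ => (analyticAt_apply i z).pow _

@[fun_prop]
theorem AnalyticAt.coordMonomial_comp {G : Type*} [NormedAddCommGroup G] [NormedSpace K G]
    {f : G → ι → K} {x : G} (hf : AnalyticAt K f x) (α : ι → ℕ) :
    AnalyticAt K (fun y => coordMonomial α (f y)) x :=
  AnalyticAt.fun_comp (analyticAt_coordMonomial α _) hf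

theorem not_eventually_coordMonomial_eq_zero (α : ι → ℕ) :
    ¬ ∀ᶠ z in 𝓝 (0 : ι → K), coordMonomial α z = 0 := by
  intro h
  obtain ⟨z, hz, hz'⟩ := exists_of_eventually_nhds_zero ∅ h
  exact coordMonomial_ne_zero (fun i _ hi => (hz' i).1 hi) hz

theorem eventually_eq_of_coordMonomial_mul {α : ι → ℕ} {f g : (ι → K) → K}
    (hf : AnalyticAt K f 0) (hg : AnalyticAt K g 0)
    (h : ∀ᶠ z in 𝓝 0, coordMonomial α z * f z = coordMonomial α z * g z) :
    ∀ᶠ z in 𝓝 0, f z = g z := by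
  have := (analyticAt_coordMonomial (K := K) α 0).eventually_eq_zero_or_of_mul (hf.fun_sub hg) (by
    filter_upwards [h] with z hz
    rw [mul_sub, hz, sub_self])
  filter_upwards [this.resolve_left (not_eventually_coordMonomial_eq_zero α)] with z hz
  exact sub_eq_zero.1 hz

/-- Near `0`, `f` is a monomial times a unit. -/
def IsMonomialUnit (f : (ι → K) → K) : Prop :=
  ∃ (α : ι → ℕ) (u : (ι → K) → K), AnalyticAt K u 0 ∧ u 0 ≠ 0 ∧
    ∀ᶠ z in 𝓝 0, f z = coordMonomial α z * u z

theorem IsMonomialUnit.congr {f g : (ι → K) → K} (hf : IsMonomialUnit f) (h : f =ᶠ[𝓝 0] g) :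
    IsMonomialUnit g := by
  obtain ⟨α, u, hu, hu0, he⟩ := hf
  exact ⟨α, u, hu, hu0, by filter_upwards [he, h] with z h1 h2; rw [← h2, h1]⟩

theorem isMonomialUnit_of_ne_zero {f : (ι → K) → K} (hf : AnalyticAt K f 0) (h0 : f 0 ≠ 0) :
    IsMonomialUnit f :=
  ⟨0, f, hf, h0, by simp [coordMonomial_zero]⟩

theorem IsMonomialUnit.of_mul_left [CompleteSpace K] {f h : (ι → K) → K} (hf : AnalyticAt K f 0)
    (hh : AnalyticAt K h 0) (hfh : IsMonomialUnit fun z => f z * h z) : IsMonomialUnit f := by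
  classical
  obtain ⟨α, u, hu, hu0, he⟩ := hfh
  induction hs : ∑ i, α i generalizing f h α with
  | zero =>
    have hα : α = 0 := by
      funext i
      exact (Finset.sum_eq_zero_iff.1 hs) i (Finset.mem_univ i)
    refine isMonomialUnit_of_ne_zero hf fun h0 => hu0 ?_
    have := he.self_of_nhds
    simpa [hα, coordMonomial_zero, h0] using this.symm
  | succ s ih =>
    obtain ⟨i, hi⟩ : ∃ i, α i ≠ 0 := by
      by_contra! hcon
      simp [hcon] at hs
    set α' := α - Pi.single i 1 with hα'
    have hs' : ∑ j, α' j = s := by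
      have h1 : ∑ j, α j = ∑ j, (Pi.single i 1 : ι → ℕ) j + ∑ j, α' j := by
        rw [← Finset.sum_add_distrib]
        refine Finset.sum_congr rfl fun j _ => ?_
        simp only [hα', Pi.sub_apply]
        by_cases hj : j = i
        · subst hj; simp; omega
        · simp [hj]
      rw [hs] at h1
      simp at h1
      omega
    let l : (ι → K) →L[K] K := ContinuousLinearMap.proj i
    let P : (ι → K) →L[K] (ι → K) :=
      ContinuousLinearMap.id K _ - l.smulRight (Pi.single i 1)
    have hP : ∀ x, x = P x + l x • (Pi.single i 1 : ι → K) := fun x => by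
      simp [P]
    have hPi : ∀ x, P x i = 0 := fun x => by simp [P, l]
    have hPt : Tendsto P (𝓝 0) (𝓝 0) := by simpa using P.continuous.tendsto 0
    have hz : ∀ᶠ x in 𝓝 0, f (P x) * h (P x) = 0 := by
      filter_upwards [hPt.eventually he] with x hx
      rw [hx, coordMonomial_eq_zero hi (hPi x), zero_mul]
    have hPa : AnalyticAt K P 0 := P.analyticAt 0
    have key : ∀ {f h : (ι → K) → K}, AnalyticAt K f 0 → AnalyticAt K h 0 →
        (∀ᶠ z in 𝓝 0, f z * h z = coordMonomial α z * u z) → (∀ᶠ x in 𝓝 0, f (P x) = 0) →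
        ∃ q, AnalyticAt K q 0 ∧ (∀ᶠ z in 𝓝 0, f z = z i * q z) ∧
          ∀ᶠ z in 𝓝 0, q z * h z = coordMonomial α' z * u z := by
      intro f h hf hh he hfP
      obtain ⟨q, hq, hqe⟩ := hf.exists_eq_add_mul P l _ hP
      have hfq : ∀ᶠ z in 𝓝 0, f z = z i * q z := by
        filter_upwards [hfP, hqe] with z h1 h2
        rw [h2, h1, zero_add]; rfl
      refine ⟨q, hq, hfq, eventually_eq_of_coordMonomial_mul (α := Pi.single i 1)
        (by fun_prop) (by fun_prop) ?_⟩
      filter_upwards [hfq, he] with z h1 h2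
      rw [coordMonomial_eq_mul hi, h1] at h2
      rw [coordMonomial_single]
      linear_combination h2
    rcases (hf.comp_zero hPa (map_zero P)).eventually_eq_zero_or_of_mul
      (hh.comp_zero hPa (map_zero P)) hz with h1 | h1
    · obtain ⟨q, hq, hfq, hqe⟩ := key hf hh he h1
      obtain ⟨β, v, hv, hv0, hve⟩ := ih hq hh α' hqe hs'
      refine ⟨Pi.single i 1 + β, v, hv, hv0, ?_⟩
      filter_upwards [hfq, hve] with z h1 h2
      rw [h1, h2, coordMonomial_add, coordMonomial_single, mul_assoc]
    · obtain ⟨q, hq, hfq, hqe⟩ := key hh hf (by simpa only [mul_comm] using he) h1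
      exact ih hf hq α' (by simpa only [mul_comm] using hqe) hs'

theorem IsMonomialUnit.of_prod [CompleteSpace K] {J : Type*} {s : Finset J} {f : J → (ι → K) → K}
    (hf : ∀ j ∈ s, AnalyticAt K (f j) 0) (h : IsMonomialUnit fun z => ∏ j ∈ s, f j z)
    {j : J} (hj : j ∈ s) : IsMonomialUnit (f j) := by
  classical
  refine IsMonomialUnit.of_mul_left (h := fun z => ∏ k ∈ s.erase j, f k z) (hf j hj)
    (Finset.analyticAt_fun_prod _ fun k hk => hf k (Finset.mem_of_mem_erase hk)) ?_
  exact h.congr (Eventually.of_forall fun z => (Finset.mul_prod_erase s (fun k => f k z) hj).symm)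

/-- Two monomials times units whose difference is again such, or vanishes, are comparable. -/
theorem le_or_le_of_sub_isMonomialUnit [CompleteSpace K] {α β : ι → ℕ} {f g u v : (ι → K) → K}
    (hu : AnalyticAt K u 0) (hu0 : u 0 ≠ 0) (hv : AnalyticAt K v 0) (hv0 : v 0 ≠ 0)
    (hf : ∀ᶠ z in 𝓝 0, f z = coordMonomial α z * u z)
    (hg : ∀ᶠ z in 𝓝 0, g z = coordMonomial β z * v z)
    (h : (∀ᶠ z in 𝓝 0, f z - g z = 0) ∨ IsMonomialUnit fun z => f z - g z) : α ≤ β ∨ β ≤ α := by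
  classical
  by_contra hcon
  rw [not_or] at hcon
  obtain ⟨j, hj⟩ : ∃ j, β j < α j := by simpa [Pi.le_def] using hcon.1
  obtain ⟨k, hk⟩ : ∃ k, α k < β k := by simpa [Pi.le_def] using hcon.2
  set γ := α ⊓ β
  set α' := α - γ with hα'
  set β' := β - γ with hβ'
  have hαe : α = γ + α' := (add_tsub_cancel_of_le inf_le_left).symm
  have hβe : β = γ + β' := (add_tsub_cancel_of_le inf_le_right).symm
  have hdis : ∀ i, α' i = 0 ∨ β' i = 0 := by
    intro i
    simp only [hα', hβ', γ, Pi.sub_apply, Pi.inf_apply]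
    rcases le_total (α i) (β i) with h | h
    · left; simp [h]
    · right; simp [h]
  have hj' : α' j ≠ 0 := by
    simp only [hα', γ, Pi.sub_apply, Pi.inf_apply]
    rw [inf_of_le_right hj.le]
    omega
  have hk' : β' k ≠ 0 := by
    simp only [hβ', γ, Pi.sub_apply, Pi.inf_apply]
    rw [inf_of_le_left hk.le]
    omega
  set d : (ι → K) → K := fun z => coordMonomial α' z * u z - coordMonomial β' z * v z with hd
  have hda : AnalyticAt K d 0 := by fun_prop
  have hde : ∀ᶠ z in 𝓝 0, f z - g z = coordMonomial γ z * d z := by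
    filter_upwards [hf, hg] with z h1 h2
    rw [h1, h2, hd, hαe, hβe, coordMonomial_add, coordMonomial_add]
    ring
  have hd0 : ∃ i, ∀ᶠ z in 𝓝 0, z i = 0 → d z = 0 := by
    rcases h with h | h
    · refine ⟨j, ?_⟩
      have : ∀ᶠ z in 𝓝 0, d z = 0 := eventually_eq_of_coordMonomial_mul (α := γ) hda
        analyticAt_const (by filter_upwards [h, hde] with z h1 h2; rw [← h2, h1, mul_zero])
      filter_upwards [this] with z hz _ using hz
    · obtain ⟨δ, w, hw, hw0, hwe⟩ : IsMonomialUnit d :=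
        IsMonomialUnit.of_mul_left (h := coordMonomial γ) hda (by fun_prop)
          (h.congr (by filter_upwards [hde] with z hz; rw [hz, mul_comm]))
      obtain ⟨i, hi⟩ : ∃ i, δ i ≠ 0 := by
        by_contra! hδ
        have h1 := hwe.self_of_nhds
        rw [show δ = 0 from funext hδ, coordMonomial_zero, one_mul] at h1
        apply hw0
        rw [← h1, hd]
        simp [coordMonomial_eq_zero hj' (z := (0 : ι → K)) rfl,
          coordMonomial_eq_zero hk' (z := (0 : ι → K)) rfl]
      refine ⟨i, ?_⟩
      filter_upwards [hwe] with z hz hzi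
      rw [hz, coordMonomial_eq_zero hi hzi, zero_mul]
  obtain ⟨i, hi⟩ := hd0
  have main : ∀ {α' β' : ι → ℕ} {u v : (ι → K) → K} {j : ι}, AnalyticAt K v 0 → v 0 ≠ 0 →
      (∀ᶠ z in 𝓝 0, z i = 0 → coordMonomial α' z * u z = coordMonomial β' z * v z) → α' j ≠ 0 →
      β' j = 0 → β' i = 0 → False := by
    intro α' β' u v j hv hv0 h hα hβ hβi
    obtain ⟨z, ⟨hz1, hz2⟩, hz⟩ := exists_of_eventually_nhds_zero {i, j}
      (h.and (hv.continuousAt.eventually_ne hv0))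
    have h1 := hz1 ((hz i).2 (by simp))
    rw [coordMonomial_eq_zero hα ((hz j).2 (by simp)), zero_mul] at h1
    refine mul_ne_zero (coordMonomial_ne_zero fun l hl hzl => ?_) hz2 h1.symm
    rcases (hz l).1 hzl with rfl | rfl
    exacts [hl hβi, hl hβ]
  rcases hdis i with h1 | h1
  · exact main hu hu0 (by filter_upwards [hi] with z hz hzi; exact (sub_eq_zero.1 (hz hzi)).symm)
      hk' ((hdis k).resolve_right hk') h1
  · exact main hv hv0 (by filter_upwards [hi] with z hz hzi; exact sub_eq_zero.1 (hz hzi))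
      hj' ((hdis j).resolve_left hj') h1

end NormalForm

section Lift
variable {X Y Z : Type*}

/-- `π` is analytic at `0`, fixes the origin, and lifts a subsequence of `b` to a sequence `c`
tending to `0`. -/
structure AnalyticLift (K : Type*) [NontriviallyNormedField K]
    [NormedAddCommGroup X] [NormedSpace K X] [NormedAddCommGroup Y] [NormedSpace K Y]
    (π : X → Y) (b : ℕ → Y) (c : ℕ → X) : Prop where
  analyticAt : AnalyticAt K π 0
  map_zero : π 0 = 0
  tendsto : Tendsto c atTop (𝓝 0)
  exists_subseq : ∃ φ : ℕ → ℕ, StrictMono φ ∧ ∀ k, π (c k) = b (φ k)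

variable {K : Type*} [NontriviallyNormedField K]
  [NormedAddCommGroup X] [NormedSpace K X] [NormedAddCommGroup Y] [NormedSpace K Y]
  [NormedAddCommGroup Z] [NormedSpace K Z]

theorem AnalyticLift.comp {π : Y → Z} {ρ : X → Y} {b : ℕ → Z} {c : ℕ → Y} {d : ℕ → X}
    (hπ : AnalyticLift K π b c) (hρ : AnalyticLift K ρ c d) :
    AnalyticLift K (fun x => π (ρ x)) b d := by
  obtain ⟨φ, hφ, hφb⟩ := hπ.exists_subseq
  obtain ⟨ψ, hψ, hψc⟩ := hρ.exists_subseq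
  exact ⟨hπ.analyticAt.comp_zero hρ.analyticAt hρ.map_zero, by rw [hρ.map_zero, hπ.map_zero],
    hρ.tendsto, φ ∘ ψ, hφ.comp hψ, fun k => by rw [hψc, hφb, Function.comp_apply]⟩

theorem AnalyticLift.tendsto_zero {π : X → Y} {b : ℕ → Y} {c : ℕ → X}
    (hπ : AnalyticLift K π b c) : Tendsto π (𝓝 0) (𝓝 0) := by
  simpa only [hπ.map_zero] using hπ.analyticAt.continuousAt.tendsto

theorem AnalyticLift.prodMap {π : X → Y} {b : ℕ → Y × Z} {c : ℕ → X}
    (hπ : AnalyticLift K π (fun k => (b k).1) c) (hb : Tendsto b atTop (𝓝 0)) :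
    ∃ c', AnalyticLift K (fun x : X × Z => (π x.1, x.2)) b c' := by
  obtain ⟨φ, hφ, hφb⟩ := hπ.exists_subseq
  refine ⟨fun k => (c k, (b (φ k)).2), ?_, by simp [hπ.map_zero], ?_, φ, hφ, fun k => ?_⟩
  · exact (AnalyticAt.comp_zero hπ.analyticAt (f := fun x : X × Z => x.1) (by fun_prop) rfl).prod
      (by fun_prop)
  · exact hπ.tendsto.prodMk_nhds
      (((continuous_snd.tendsto (0 : Y × Z)).comp hb).comp hφ.tendsto_atTop)
  · rw [hφb]

/-- After an analytic lift of a subsequence of `b`, `f` becomes a monomial times a unit in `n`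
variables. -/
def Uniformizes (n : ℕ) (f : Y → K) (b : ℕ → Y) : Prop :=
  ∃ (π : (Fin n → K) → Y) (c : ℕ → Fin n → K), AnalyticLift K π b c ∧
    IsMonomialUnit fun x => f (π x)

theorem Uniformizes.of_lift {n : ℕ} {f : Y → K} {b : ℕ → Y} {c : ℕ → X} {π : X → Y}
    (hπ : AnalyticLift K π b c) (h : Uniformizes n (fun x => f (π x)) c) : Uniformizes n f b := by
  obtain ⟨ρ, d, hρ, h⟩ := h
  exact ⟨_, d, hπ.comp hρ, h⟩

theorem Uniformizes.congr {n : ℕ} {f g : Y → K} {b : ℕ → Y} (h : Uniformizes n f b)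
    (hfg : f =ᶠ[𝓝 0] g) : Uniformizes n g b := by
  obtain ⟨ρ, d, hρ, h⟩ := h
  exact ⟨ρ, d, hρ, h.congr (hρ.tendsto_zero.eventually hfg)⟩

theorem uniformizes_of_eventually_eq {n : ℕ} {f : (Fin n → K) × K → K} {b : ℕ → (Fin n → K) × K}
    (hb : Tendsto b atTop (𝓝 0)) {α : Fin n → ℕ} {m : ℕ} {u : (Fin n → K) × K → K}
    (hu : AnalyticAt K u 0) (hu0 : u 0 ≠ 0)
    (h : ∀ᶠ x in 𝓝 0, f x = coordMonomial α x.1 * x.2 ^ m * u x) : Uniformizes (n + 1) f b := by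
  have hL : AnalyticLift K (fun (x : Fin (n + 1) → K) => ((fun i => x i.succ : Fin n → K), x 0)) b
      (fun k => Fin.cons (b k).2 (b k).1) := by
    refine ⟨?_, rfl, ?_, id, strictMono_id, fun k => ?_⟩
    · exact (AnalyticAt.pi fun i => by fun_prop).prod (by fun_prop)
    · refine tendsto_pi_nhds.2 fun i => ?_
      refine Fin.cases ?_ (fun j => ?_) i
      · exact (continuous_snd.tendsto 0).comp hb
      · exact (((continuous_apply j).comp continuous_fst).tendsto 0).comp hb
    · simp
  refine ⟨_, _, hL, Fin.cons m α, fun x => u (fun i => x i.succ, x 0),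
    hu.comp_zero hL.analyticAt rfl, hu0, ?_⟩
  filter_upwards [hL.tendsto_zero.eventually h] with x hx
  rw [hx]
  simp only [coordMonomial, Fin.prod_univ_succ, Fin.cons_zero, Fin.cons_succ]
  ring

variable (K) in
/-- Every nonzero germ in `n` variables is uniformized along every sequence tending to `0`. -/
def UniformizationHolds (n : ℕ) : Prop :=
  ∀ f : (Fin n → K) → K, AnalyticAt K f 0 → (¬ ∀ᶠ z in 𝓝 0, f z = 0) →
    ∀ b : ℕ → Fin n → K, Tendsto b atTop (𝓝 0) → Uniformizes n f b

theorem not_eventually_prod_eq_zero {J : Type*} (s : Finset J) {f : J → X → K}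
    (hf : ∀ j ∈ s, AnalyticAt K (f j) 0) (h : ∀ j ∈ s, ¬ ∀ᶠ z in 𝓝 0, f j z = 0) :
    ¬ ∀ᶠ z in 𝓝 0, ∏ j ∈ s, f j z = 0 := by
  classical
  induction s using Finset.induction_on with
  | empty => exact fun h => by simpa using h.self_of_nhds
  | insert a s ha ih =>
    intro hz
    simp only [Finset.prod_insert ha] at hz
    simp only [Finset.mem_insert, forall_eq_or_imp] at hf h
    rcases hf.1.eventually_eq_zero_or_of_mul (Finset.analyticAt_fun_prod s hf.2) hz with h1 | h1
    exacts [h.1 h1, ih hf.2 h.2 h1]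

theorem UniformizationHolds.simultaneous [CompleteSpace K] {n : ℕ} (H : UniformizationHolds K n)
    (S : Finset ((Fin n → K) → K)) (hS : ∀ f ∈ S, AnalyticAt K f 0) {b : ℕ → Fin n → K}
    (hb : Tendsto b atTop (𝓝 0)) :
    ∃ (π : (Fin n → K) → Fin n → K) (c : ℕ → Fin n → K), AnalyticLift K π b c ∧
      ∀ f ∈ S, (∀ᶠ z in 𝓝 0, f z = 0) ∨ IsMonomialUnit fun z => f (π z) := by
  classical
  set T := S.filter fun f => ¬ ∀ᶠ z in 𝓝 0, f z = 0
  have hTS : ∀ f ∈ T, AnalyticAt K f 0 := fun f hf => hS f (Finset.mem_filter.1 hf).1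
  obtain ⟨π, c, hπ, h⟩ := H (fun z => ∏ f ∈ T, f z) (Finset.analyticAt_fun_prod T hTS)
    (not_eventually_prod_eq_zero T hTS fun f hf => (Finset.mem_filter.1 hf).2) b hb
  refine ⟨π, c, hπ, fun f hf => or_iff_not_imp_left.2 fun hf0 => ?_⟩
  exact IsMonomialUnit.of_prod (s := T) (f := fun f z => f (π z))
    (fun f hf => (hTS f hf).comp_zero hπ.analyticAt hπ.map_zero) h (Finset.mem_filter.2 ⟨hf, hf0⟩)

/-- Sequences tending to `0` are, along a subsequence, constant multiples of `N`-th powers. -/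
theorem exists_subseq_eq_mul_pow [ProperSpace K] {N : ℕ} (hN : (N : K) ≠ 0) {x : ℕ → K}
    (hx : Tendsto x atTop (𝓝 0)) :
    ∃ (a : K) (φ : ℕ → ℕ) (y : ℕ → K), a ≠ 0 ∧ StrictMono φ ∧ Tendsto y atTop (𝓝 0) ∧
      ∀ k, x (φ k) = a * y k ^ N := by
  have hN0 : N ≠ 0 := by rintro rfl; simp at hN
  obtain ⟨c, hc⟩ := NormedField.exists_one_lt_norm K
  have hc0 : c ≠ 0 := by rintro rfl; simp at hc; linarith
  have hsw : ∀ k, ∃ s w : K, x k = s ^ N * w ∧ 1 ≤ ‖w‖ ∧ ‖w‖ ≤ ‖c‖ ^ N := by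
    intro k
    by_cases hk : x k = 0
    · exact ⟨0, 1, by simp [hk, hN0], by simp, by simpa using one_le_pow₀ hc.le⟩
    · obtain ⟨m, hm1, hm2⟩ := exists_mem_Ico_zpow (norm_pos_iff.2 hk) (one_lt_pow₀ hc hN0)
      have hcm : (c ^ m) ^ N ≠ 0 := pow_ne_zero _ (zpow_ne_zero _ hc0)
      have hn : ‖(c ^ m) ^ N‖ = (‖c‖ ^ N) ^ m := by
        rw [norm_pow, norm_zpow, ← zpow_natCast, ← zpow_natCast, ← zpow_mul, ← zpow_mul, mul_comm]
      have hpos : 0 < (‖c‖ ^ N) ^ m := hn ▸ norm_pos_iff.2 hcm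
      refine ⟨c ^ m, x k / (c ^ m) ^ N, by field_simp, ?_, ?_⟩
      · rw [norm_div, hn, le_div_iff₀ hpos, one_mul]; exact hm1
      · rw [norm_div, hn, div_le_iff₀ hpos]
        rw [zpow_add_one₀ (pow_ne_zero _ (norm_ne_zero_iff.2 hc0)), mul_comm] at hm2
        exact hm2.le
  choose s w hsw hw1 hw2 using hsw
  obtain ⟨a, -, φ, hφ, hφa⟩ := tendsto_subseq_of_bounded (Metric.isBounded_closedBall (x := (0 : K))
    (r := ‖c‖ ^ N)) (x := w) (fun k => by simpa using hw2 k)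
  have ha1 : 1 ≤ ‖a‖ := ge_of_tendsto' hφa.norm fun k => hw1 _
  have ha0 : a ≠ 0 := norm_pos_iff.1 (by linarith)
  have hroot : ∀ᶠ v in 𝓝 (1 : K), ∃ r : K, ‖r‖ ≤ 2 ∧ r ^ N = v := by
    have h1 : HasStrictDerivAt (fun r : K => r ^ N) (N : K) 1 := by
      simpa using hasStrictDerivAt_pow N (1 : K)
    have h2 := h1.map_nhds_eq hN
    rw [one_pow] at h2
    rw [← h2, eventually_map]
    filter_upwards [Metric.ball_mem_nhds (1 : K) one_pos] with r hr
    refine ⟨r, ?_, rfl⟩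
    have : ‖r‖ ≤ ‖r - 1‖ + ‖(1 : K)‖ := by simpa using norm_add_le (r - 1) 1
    rw [Metric.mem_ball, dist_eq_norm] at hr
    rw [norm_one] at this
    linarith
  have hwa : Tendsto (fun k => w (φ k) / a) atTop (𝓝 1) := by
    simpa [ha0] using hφa.div_const a
  obtain ⟨M, hM⟩ := eventually_atTop.1 (hwa.eventually hroot)
  choose! r hr2 hrN using hM
  have hs0 : Tendsto s atTop (𝓝 0) := by
    have h1 : Tendsto (fun k => ‖s k‖ ^ N) atTop (𝓝 0) := by
      refine squeeze_zero (fun k => by positivity) (fun k => ?_) (tendsto_zero_iff_norm_tendsto_zero.1 hx)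
      rw [hsw k, norm_mul, norm_pow]
      exact le_mul_of_one_le_right (by positivity) (hw1 k)
    refine tendsto_zero_iff_norm_tendsto_zero.2 ?_
    have h2 := (h1.rpow_const (p := (N : ℝ)⁻¹) (Or.inr (by positivity)))
    rw [Real.zero_rpow (by positivity)] at h2
    refine h2.congr fun k => ?_
    rw [← Real.rpow_natCast, ← Real.rpow_mul (norm_nonneg _), mul_inv_cancel₀ (by exact_mod_cast hN0),
      Real.rpow_one]
  refine ⟨a, fun k => φ (k + M), fun k => s (φ (k + M)) * r (k + M), ha0,
    fun i j h => hφ (by omega), ?_, fun k => ?_⟩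
  · have h1 : Tendsto (fun k => s (φ (k + M))) atTop (𝓝 0) :=
      (hs0.comp hφ.tendsto_atTop).comp (tendsto_add_atTop_nat M)
    refine squeeze_zero_norm (a := fun k => ‖s (φ (k + M))‖ * 2) (fun k => ?_) ?_
    · rw [norm_mul]
      exact mul_le_mul_of_nonneg_left (hr2 _ (by omega)) (norm_nonneg _)
    · simpa using h1.norm.mul_const 2
  · rw [hsw, mul_pow, hrN _ (by omega)]
    field_simp

theorem exists_power_lift [ProperSpace K] {n N : ℕ} (hN : (N : K) ≠ 0) {b : ℕ → Fin n → K}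
    (hb : Tendsto b atTop (𝓝 0)) :
    ∃ (a : Fin n → K) (c : ℕ → Fin n → K), (∀ i, a i ≠ 0) ∧
      AnalyticLift K (fun z i => a i * z i ^ N) b c := by
  have key : ∀ s : Finset (Fin n), ∃ φ : ℕ → ℕ, StrictMono φ ∧ ∀ i ∈ s, ∃ (a : K) (y : ℕ → K),
      a ≠ 0 ∧ Tendsto y atTop (𝓝 0) ∧ ∀ k, b (φ k) i = a * y k ^ N := by
    intro s
    induction s using Finset.induction_on with
    | empty => exact ⟨id, strictMono_id, by simp⟩
    | insert i s hi ih =>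
      obtain ⟨φ, hφ, h⟩ := ih
      obtain ⟨a, ψ, y, ha, hψ, hy, hxy⟩ := exists_subseq_eq_mul_pow hN
        ((tendsto_pi_nhds.1 hb i).comp hφ.tendsto_atTop)
      refine ⟨φ ∘ ψ, hφ.comp hψ, fun j hj => ?_⟩
      rcases Finset.mem_insert.1 hj with rfl | hj
      · exact ⟨a, y, ha, hy, hxy⟩
      · obtain ⟨a', y', ha', hy', h'⟩ := h j hj
        exact ⟨a', y' ∘ ψ, ha', hy'.comp hψ.tendsto_atTop, fun k => h' (ψ k)⟩
  obtain ⟨φ, hφ, h⟩ := key Finset.univ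
  choose a y ha hy hxy using fun i => h i (Finset.mem_univ i)
  have hN0 : N ≠ 0 := by rintro rfl; simp at hN
  refine ⟨a, fun k i => y i k, ha, AnalyticAt.pi fun i => by fun_prop, ?_, tendsto_pi_nhds.2 hy,
    φ, hφ, fun k => ?_⟩
  · funext i; simp [hN0]
  · funext i; exact (hxy i k).symm

/-- One of two sequences in a locally compact field is a convergent multiple of the other, along a
subsequence. -/
theorem exists_subseq_mul_or [ProperSpace K] (x y : ℕ → K) :
    ∃ φ : ℕ → ℕ, StrictMono φ ∧
      ((∃ (τ : K) (c : ℕ → K), Tendsto c atTop (𝓝 τ) ∧ ∀ k, y (φ k) = x (φ k) * c k) ∨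
        ∃ c : ℕ → K, Tendsto c atTop (𝓝 0) ∧ ∀ k, x (φ k) = y (φ k) * c k) := by
  have key : ∀ x y : ℕ → K, (∃ᶠ k in atTop, ‖y k‖ ≤ ‖x k‖) → ∃ φ : ℕ → ℕ, StrictMono φ ∧
      ∃ (τ : K) (c : ℕ → K), Tendsto c atTop (𝓝 τ) ∧ ∀ k, y (φ k) = x (φ k) * c k := by
    intro x y h
    obtain ⟨φ, hφ, hle⟩ := extraction_of_frequently_atTop h
    obtain ⟨τ, -, ψ, hψ, hτ⟩ := tendsto_subseq_of_bounded
      (Metric.isBounded_closedBall (x := (0 : K)) (r := 1)) (x := fun k => y (φ k) / x (φ k))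
      (fun k => by
        rw [mem_closedBall_zero_iff, norm_div]
        exact div_le_one_of_le₀ (hle k) (norm_nonneg _))
    refine ⟨φ ∘ ψ, hφ.comp hψ, τ, _, hτ, fun k => ?_⟩
    by_cases h0 : x (φ (ψ k)) = 0
    · have := hle (ψ k)
      rw [h0, norm_zero, norm_le_zero_iff] at this
      simp [h0, this]
    · simp only [Function.comp_apply]
      field_simp
  by_cases h : ∃ᶠ k in atTop, ‖y k‖ ≤ ‖x k‖
  · obtain ⟨φ, hφ, h'⟩ := key x y h
    exact ⟨φ, hφ, Or.inl h'⟩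
  · have h' : ∃ᶠ k in atTop, ‖x k‖ ≤ ‖y k‖ := by
      rw [not_frequently] at h
      exact (h.mono fun k hk => (not_le.1 hk).le).frequently
    obtain ⟨φ, hφ, τ, c, hc, hxy⟩ := key y x h'
    by_cases hτ : τ = 0
    · exact ⟨φ, hφ, Or.inr ⟨c, hτ ▸ hc, hxy⟩⟩
    · obtain ⟨M, hM⟩ := eventually_atTop.1 (hc.eventually_ne hτ)
      refine ⟨fun k => φ (k + M), fun i j hij => hφ (by omega), Or.inl ⟨τ⁻¹, fun k => (c (k + M))⁻¹,
        (hc.comp (tendsto_add_atTop_nat M)).inv₀ hτ, fun k => ?_⟩⟩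
      have := hM (k + M) (by omega)
      rw [hxy]
      field_simp

end Lift

section Uniformization
variable {K : Type*} [NontriviallyNormedField K]

theorem analyticOrderAt_le_of_eventually_eq {ψ w : K → K} {a : ℕ → K} {m j : ℕ}
    (hψ : AnalyticAt K ψ 0) (hw : ContinuousAt w 0)
    (h : ∀ᶠ t in 𝓝 0, ψ t = ∑ j ∈ Finset.range (m + 1), a j * t ^ j + t ^ (m + 1) * w t)
    (hj : j ≤ m) (ha : a j ≠ 0) : analyticOrderAt ψ 0 ≤ m := by
  by_contra! hlt
  have hle : ((m + 1 : ℕ) : ℕ∞) ≤ analyticOrderAt ψ 0 := by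
    push_cast
    exact Order.add_one_le_of_lt hlt
  obtain ⟨g, hg, hge⟩ := (natCast_le_analyticOrderAt hψ).1 hle
  refine ha ((eq_of_eventually_sum_mul_pow_add_eq (d := m + 1) (b := fun _ => 0) hw hg.continuousAt ?_).1 j
    (by omega))
  filter_upwards [h, hge] with t h1 h2
  rw [← h1, h2]
  simp

/-- A polynomial of degree `m + 1` without term of degree `m`, translated by `τ ≠ 0`, vanishes to
order at most `m` at the origin. -/
theorem analyticOrderAt_translate_le [CharZero K] {v : ℕ → K} {u τ : K} {m : ℕ} (hu : u ≠ 0)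
    (hτ : τ ≠ 0) {ψ : K → K} (hψ : AnalyticAt K ψ 0) (h : ∀ᶠ t in 𝓝 0, ψ t =
      ∑ j ∈ Finset.range m, v j * (τ + t) ^ j + (τ + t) ^ (m + 1) * u) :
    analyticOrderAt ψ 0 ≤ m := by
  set P : Polynomial K := ∑ j ∈ Finset.range m, Polynomial.monomial j (v j) +
    Polynomial.monomial (m + 1) u with hP
  have hdeg : P.natDegree ≤ m + 1 := by
    refine Polynomial.natDegree_add_le_of_degree_le (Polynomial.natDegree_sum_le_of_forall_le _ _
      fun j hj => ?_) (Polynomial.natDegree_monomial_le _)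
    exact (Polynomial.natDegree_monomial_le _).trans (by have := Finset.mem_range.1 hj; omega)
  have hcoeff : (Polynomial.taylor τ P).coeff m = (m + 1) * u * τ := by
    rw [Polynomial.taylor_coeff, hP, map_add, map_sum, Polynomial.eval_add,
      Polynomial.eval_finsetSum, Finset.sum_eq_zero, Polynomial.hasseDeriv_monomial]
    · simp
    · intro j hj
      rw [Polynomial.hasseDeriv_monomial, Nat.choose_eq_zero_of_lt (Finset.mem_range.1 hj)]
      simp
  refine analyticOrderAt_le_of_eventually_eq (a := (Polynomial.taylor τ P).coeff)
    (w := fun _ => (Polynomial.taylor τ P).coeff (m + 1)) hψ continuousAt_const ?_ le_rfl ?_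
  · filter_upwards [h] with t ht
    have h1 : (Polynomial.taylor τ P).eval t = P.eval (t + τ) := Polynomial.taylor_eval ..
    rw [Polynomial.eval_eq_sum_range' (n := m + 2)
      (by rw [Polynomial.natDegree_taylor]; omega), Finset.sum_range_succ] at h1
    rw [ht, mul_comm (t ^ (m + 1)), h1, hP]
    simp [Polynomial.eval_finsetSum, add_comm, mul_comm]
  · rw [hcoeff]
    exact mul_ne_zero (mul_ne_zero (by exact_mod_cast m.succ_ne_zero) hu) hτ

variable (K) in
/-- Uniformization for products of a germ in the first `n` variables and a germ which is regular
of order at most `d` in the last variable. -/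
def RegularUniformizationHolds (n d : ℕ) : Prop :=
  ∀ (h : (Fin n → K) × K → K) (e : (Fin n → K) → K) (b : ℕ → (Fin n → K) × K), AnalyticAt K h 0 →
    analyticOrderAt (fun t : K => h (0, t)) 0 ≤ d → AnalyticAt K e 0 →
    (¬ ∀ᶠ z in 𝓝 0, e z = 0) → Tendsto b atTop (𝓝 0) →
    Uniformizes (n + 1) (fun x => e x.1 * h x) b

theorem analyticLift_chart {n : ℕ} {b : ℕ → (Fin n → K) × K} (hb : Tendsto b atTop (𝓝 0))
    (i : Fin n) {φ : ℕ → ℕ} (hφ : StrictMono φ) {τ : K} {c : ℕ → K} (hc : Tendsto c atTop (𝓝 τ))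
    (h : ∀ k, (b (φ k)).2 = (b (φ k)).1 i * c k) :
    AnalyticLift K (fun x : (Fin n → K) × K => (x.1, x.1 i * (τ + x.2))) b
      (fun k => ((b (φ k)).1, c k - τ)) := by
  refine ⟨by fun_prop, by simp, ?_, φ, hφ, fun k => ?_⟩
  · refine (((continuous_fst.tendsto (0 : (Fin n → K) × K)).comp hb).comp
      hφ.tendsto_atTop).prodMk_nhds ?_
    simpa using hc.sub_const τ
  · ext1
    · rfl
    · simp [h]

theorem analyticLift_chart' {n : ℕ} {b : ℕ → (Fin n → K) × K} (hb : Tendsto b atTop (𝓝 0))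
    (i : Fin n) {φ : ℕ → ℕ} (hφ : StrictMono φ) {c : ℕ → K} (hc : Tendsto c atTop (𝓝 0))
    (h : ∀ k, (b (φ k)).1 i = (b (φ k)).2 * c k) :
    AnalyticLift K (fun x : (Fin n → K) × K => ((fun j => if j = i then x.2 * x.1 j else x.1 j :
      Fin n → K), x.2)) b (fun k => (Function.update (b (φ k)).1 i (c k), (b (φ k)).2)) := by
  have hb1 : Tendsto (fun k => (b (φ k)).1) atTop (𝓝 0) :=
    ((continuous_fst.tendsto (0 : (Fin n → K) × K)).comp hb).comp hφ.tendsto_atTop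
  have hb2 : Tendsto (fun k => (b (φ k)).2) atTop (𝓝 0) :=
    ((continuous_snd.tendsto (0 : (Fin n → K) × K)).comp hb).comp hφ.tendsto_atTop
  refine ⟨?_, ?_, Tendsto.prodMk_nhds ?_ hb2, φ, hφ, fun k => ?_⟩
  · refine (AnalyticAt.pi fun j => ?_).prod (by fun_prop)
    split_ifs <;> fun_prop
  · ext <;> simp
  · simpa using hb1.update i hc
  · ext j
    · by_cases hj : j = i
      · subst hj; simp [h]
      · simp [hj]
    · rfl

theorem coordMonomial_ite_mul {n : ℕ} (α : Fin n → ℕ) (i : Fin n) (z : Fin n → K) (t : K) :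
    coordMonomial α (fun j => if j = i then t * z j else z j) = t ^ α i * coordMonomial α z := by
  simp only [coordMonomial]
  rw [← Finset.mul_prod_erase _ _ (Finset.mem_univ i),
    ← Finset.mul_prod_erase _ (fun j => z j ^ α j) (Finset.mem_univ i), if_pos rfl, mul_pow,
    mul_assoc]
  congr 2
  exact Finset.prod_congr rfl fun j hj => by rw [if_neg (Finset.ne_of_mem_erase hj)]

theorem uniformizes_of_weighted [ProperSpace K] [CharZero K] {n m : ℕ}
    (H : RegularUniformizationHolds K n m) (γ : Fin n → ℕ) (ε : Fin n → ℕ)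
    {u : (Fin n → K) × K → K} {v : ℕ → (Fin n → K) → K} {b : ℕ → (Fin n → K) × K}
    (hu : AnalyticAt K u 0) (hu0 : u 0 ≠ 0) (hv : ∀ j, AnalyticAt K (v j) 0)
    (hv0 : ∃ j < m, v j 0 ≠ 0) (hb : Tendsto b atTop (𝓝 0)) :
    Uniformizes (n + 1) (fun x => coordMonomial ε x.1 *
      (∑ j ∈ Finset.range m, coordMonomial ((m + 1 - j) • γ) x.1 * v j x.1 * x.2 ^ j +
        x.2 ^ (m + 1) * u x)) b := by
  have hv' : ∀ {f : (Fin n → K) × K → Fin n → K}, AnalyticAt K f 0 → f 0 = 0 → ∀ j,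
      AnalyticAt K (fun x => v j (f x)) 0 := fun hf h0 j => (hv j).comp_zero hf h0
  induction hs : ∑ i, γ i generalizing γ ε u b with
  | zero =>
    have hγ : γ = 0 := by
      funext i
      exact (Finset.sum_eq_zero_iff.1 hs) i (Finset.mem_univ i)
    subst hγ
    have han : AnalyticAt K (fun x : (Fin n → K) × K =>
        ∑ j ∈ Finset.range m, coordMonomial ((m + 1 - j) • (0 : Fin n → ℕ)) x.1 * v j x.1 * x.2 ^ j
          + x.2 ^ (m + 1) * u x) 0 := by
      refine (Finset.analyticAt_fun_sum _ fun j _ => ?_).fun_add (by fun_prop)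
      have := hv' (f := fun x => x.1) (by fun_prop) rfl j
      fun_prop
    refine H _ _ b han ?_ (by fun_prop) (not_eventually_coordMonomial_eq_zero ε) hb
    obtain ⟨j, hj, hj0⟩ := hv0
    refine analyticOrderAt_le_of_eventually_eq (a := fun j => if j < m then v j 0 else 0)
      (w := fun t => u (0, t)) (j := j) (han.comp_zero (f := fun t : K => ((0 : Fin n → K), t))
        (by fun_prop) rfl) ?_ ?_ hj.le (by simp [hj, hj0])
    · exact (hu.comp_zero (f := fun t : K => ((0 : Fin n → K), t)) (by fun_prop) rfl).continuousAt
    · refine Eventually.of_forall fun t => ?_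
      rw [Finset.sum_range_succ]
      simp only [lt_irrefl, if_false, zero_mul, add_zero]
      congr 1
      refine Finset.sum_congr rfl fun j hj => ?_
      rw [if_pos (Finset.mem_range.1 hj), smul_zero, coordMonomial_zero, one_mul]
  | succ s ih =>
    obtain ⟨i, hi⟩ : ∃ i, γ i ≠ 0 := by
      by_contra! hcon
      simp [hcon] at hs
    have hmon : ∀ j < m, ∀ z : Fin n → K, z i = 0 → coordMonomial ((m + 1 - j) • γ) z = 0 := by
      intro j hj z hz
      refine coordMonomial_eq_zero (i := i) ?_ hz
      simp only [Pi.smul_apply, smul_eq_mul]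
      exact mul_ne_zero (by omega) hi
    obtain ⟨φ, hφ, ⟨τ, c, hc, hxy⟩ | ⟨c, hc, hxy⟩⟩ :=
      exists_subseq_mul_or (fun k => (b k).1 i) (fun k => (b k).2)
    · have hlift := analyticLift_chart hb i hφ hc hxy
      refine Uniformizes.of_lift hlift ?_
      set γ' := γ - Pi.single i 1 with hγ'
      have hγe : γ = Pi.single i 1 + γ' := by
        refine (add_tsub_cancel_of_le ?_).symm
        intro j
        by_cases hj : j = i
        · subst hj; simp; omega
        · simp [hj]
      have hs' : ∑ j, γ' j = s := by
        have h1 : ∑ j, γ j = ∑ j, ((Pi.single i 1 : Fin n → ℕ) j + γ' j) := by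
          conv_lhs => rw [hγe]
          rfl
        rw [Finset.sum_add_distrib, hs] at h1
        simp at h1
        omega
      set u' : (Fin n → K) × K → K := fun x => u (x.1, x.1 i * (τ + x.2)) with hu'
      have hu'a : AnalyticAt K u' 0 := hu.comp_zero hlift.analyticAt hlift.map_zero
      have hu'0 : ∀ t, u' (0, t) = u 0 := by
        intro t
        simp only [hu', Pi.zero_apply, zero_mul]
        rfl
      have hfactor : ∀ x : (Fin n → K) × K, coordMonomial ε x.1 *
          (∑ j ∈ Finset.range m, coordMonomial ((m + 1 - j) • γ) x.1 * v j x.1 *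
            (x.1 i * (τ + x.2)) ^ j + (x.1 i * (τ + x.2)) ^ (m + 1) * u' x) =
          coordMonomial (ε + (m + 1) • Pi.single i 1) x.1 *
          (∑ j ∈ Finset.range m, coordMonomial ((m + 1 - j) • γ') x.1 * v j x.1 * (τ + x.2) ^ j +
            (τ + x.2) ^ (m + 1) * u' x) := by
        intro x
        rw [coordMonomial_add, coordMonomial_smul (m + 1), coordMonomial_single, mul_assoc]
        congr 1
        rw [mul_add (x.1 i ^ (m + 1)), Finset.mul_sum, mul_pow _ _ (m + 1), mul_assoc (x.1 i ^ (m + 1))]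
        congr 1
        refine Finset.sum_congr rfl fun j hj => ?_
        have hj' := Finset.mem_range.1 hj
        rw [coordMonomial_smul, coordMonomial_smul, hγe, coordMonomial_add, coordMonomial_single,
          mul_pow, mul_pow, show x.1 i ^ (m + 1) = x.1 i ^ (m + 1 - j) * x.1 i ^ j by
            rw [← pow_add]; congr 1; omega]
        ring
      simp only [hu'] at hfactor
      simp only [hfactor]
      by_cases hτ : τ = 0
      · subst hτ
        simp only [zero_add]
        simp only [hu', zero_add] at hu'a
        exact ih (u := fun x => u (x.1, x.1 i * x.2)) γ' _ hu'a (by simpa [hu'] using (hu'0 0).trans_ne hu0)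
          hlift.tendsto hs'
      · have han : AnalyticAt K (fun x : (Fin n → K) × K =>
            ∑ j ∈ Finset.range m, coordMonomial ((m + 1 - j) • γ') x.1 * v j x.1 * (τ + x.2) ^ j +
              (τ + x.2) ^ (m + 1) * u (x.1, x.1 i * (τ + x.2))) 0 := by
          refine (Finset.analyticAt_fun_sum _ fun j _ => ?_).fun_add ?_
          · have := hv' (f := fun x => x.1) (by fun_prop) rfl j
            fun_prop
          · exact AnalyticAt.fun_mul (by fun_prop) hu'a
        refine H _ _ _ han ?_ (by fun_prop) (not_eventually_coordMonomial_eq_zero _) hlift.tendsto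
        refine analyticOrderAt_translate_le (u := u 0) (τ := τ)
          (v := fun j => coordMonomial ((m + 1 - j) • γ') (0 : Fin n → K) * v j 0) hu0 hτ
          (han.comp_zero (f := fun t : K => ((0 : Fin n → K), t)) (by fun_prop) rfl) ?_
        refine Eventually.of_forall fun t => ?_
        have := hu'0 t
        simp only [hu'] at this
        simp only [this]
    · have hlift := analyticLift_chart' hb i hφ hc hxy
      refine Uniformizes.of_lift hlift ?_
      set σ : (Fin n → K) × K → Fin n → K := fun x j => if j = i then x.2 * x.1 j else x.1 j with hσ
      have hσa : AnalyticAt K σ 0 := hlift.analyticAt.fst_comp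
      have hσ0 : σ 0 = 0 := congrArg Prod.fst hlift.map_zero
      refine uniformizes_of_eventually_eq (α := ε) (m := ε i + (m + 1)) (u := fun x =>
        ∑ j ∈ Finset.range m, x.2 ^ ((m + 1 - j) * (γ i - 1)) * coordMonomial ((m + 1 - j) • γ) x.1 *
          v j (σ x) + u (σ x, x.2)) hlift.tendsto ?_ ?_ ?_
      · refine (Finset.analyticAt_fun_sum _ fun j _ => ?_).fun_add
          (hu.comp_zero hlift.analyticAt hlift.map_zero)
        exact AnalyticAt.fun_mul (by fun_prop) (hv' hσa hσ0 j)
      · rw [Finset.sum_eq_zero fun j hj => by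
          rw [hmon j (Finset.mem_range.1 hj) _ rfl, mul_zero, zero_mul], zero_add, hσ0]
        exact hu0
      · refine Eventually.of_forall fun x => ?_
        simp only [hσ, coordMonomial_ite_mul]
        rw [pow_add x.2 (ε i), mul_add, mul_add, Finset.mul_sum, Finset.mul_sum]
        congr 1
        · refine Finset.sum_congr rfl fun j hj => ?_
          have hj' := Finset.mem_range.1 hj
          have h1 : x.2 ^ ((m + 1 - j) • γ) i * x.2 ^ j =
              x.2 ^ (m + 1) * x.2 ^ ((m + 1 - j) * (γ i - 1)) := by
            rw [← pow_add, ← pow_add]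
            congr 1
            obtain ⟨g, hg⟩ := Nat.exists_eq_succ_of_ne_zero hi
            simp only [Pi.smul_apply, smul_eq_mul, hg, Nat.succ_eq_add_one, Nat.add_sub_cancel]
            rw [mul_add, mul_one]
            omega
          linear_combination (coordMonomial ε x.1 * x.2 ^ ε i * coordMonomial ((m + 1 - j) • γ) x.1 *
            v j (fun j => if j = i then x.2 * x.1 j else x.1 j)) * h1
        · ring
end Uniformization

section Induction
variable {K : Type*} [NontriviallyNormedField K]

theorem coordMonomial_mul_pow {ι : Type*} [Fintype ι] (α : ι → ℕ) (a z : ι → K) (N : ℕ) :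
    coordMonomial α (fun i => a i * z i ^ N) = coordMonomial (N • α) z * coordMonomial α a := by
  rw [coordMonomial_smul]
  simp only [coordMonomial, mul_pow, Finset.prod_mul_distrib, ← Finset.prod_pow]
  rw [mul_comm]
  congr 1
  exact Finset.prod_congr rfl fun i _ => by rw [← pow_mul, ← pow_mul, mul_comm]

theorem UniformizationHolds.regular_zero {n : ℕ} (H : UniformizationHolds K n) :
    RegularUniformizationHolds K n 0 := by
  intro h e b hh hord he hne hb
  have h0 : h 0 ≠ 0 := by
    have h1 : AnalyticAt K (fun t : K => h (0, t)) 0 := hh.comp_zero (by fun_prop) rfl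
    exact h1.analyticOrderAt_eq_zero.1 (nonpos_iff_eq_zero.1 hord)
  obtain ⟨π, c, hπ, α, w, hw, hw0, hwe⟩ := H e he hne (fun k => (b k).1)
    ((continuous_fst.tendsto (0 : (Fin n → K) × K)).comp hb)
  obtain ⟨c', hπ'⟩ := hπ.prodMap hb
  refine Uniformizes.of_lift hπ' (uniformizes_of_eventually_eq (α := α) (m := 0)
    (u := fun x => w x.1 * h (π x.1, x.2)) hπ'.tendsto ?_ ?_ ?_)
  · exact (hw.comp_zero (f := fun x : (Fin n → K) × K => x.1) (by fun_prop) rfl).fun_mul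
      (hh.comp_zero hπ'.analyticAt hπ'.map_zero)
  · exact mul_ne_zero hw0 (by simpa [hπ.map_zero] using! h0)
  · filter_upwards [(continuous_fst.tendsto (0 : (Fin n → K) × K)).eventually hwe] with x hx
    rw [hx]
    ring

theorem UniformizationHolds.of_expansion [ProperSpace K] [CharZero K] {n m : ℕ}
    (H : UniformizationHolds K n) (Hm : RegularUniformizationHolds K n m)
    {e : (Fin n → K) → K} {c : ℕ → (Fin n → K) → K} {u : (Fin n → K) × K → K}
    {b : ℕ → (Fin n → K) × K} (he : AnalyticAt K e 0) (hne : ¬ ∀ᶠ z in 𝓝 0, e z = 0)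
    (hc : ∀ j, AnalyticAt K (c j) 0) (hu : AnalyticAt K u 0) (hu0 : u 0 ≠ 0)
    (hb : Tendsto b atTop (𝓝 0)) :
    Uniformizes (n + 1) (fun x => e x.1 *
      (∑ j ∈ Finset.range m, c j x.1 * x.2 ^ j + x.2 ^ (m + 1) * u x)) b := by
  classical
  set N := (m + 1).factorial with hN
  have hN0 : (N : K) ≠ 0 := by exact_mod_cast (m + 1).factorial_ne_zero
  have hNdvd : ∀ j, j < m → N = (m + 1 - j) * (N / (m + 1 - j)) := fun j hj =>
    (Nat.mul_div_cancel' (Nat.dvd_factorial (by omega) (by omega))).symm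
  let dif : ℕ × ℕ → (Fin n → K) → K := fun q z =>
    c q.1 z ^ (N / (m + 1 - q.1)) - c q.2 z ^ (N / (m + 1 - q.2))
  obtain ⟨π, c₁, hπ, hS⟩ := H.simultaneous
    (insert e ((Finset.range m).image c ∪ (Finset.range m ×ˢ Finset.range m).image dif))
    (by
      intro f hf
      simp only [Finset.mem_insert, Finset.mem_union, Finset.mem_image] at hf
      rcases hf with rfl | ⟨j, -, rfl⟩ | ⟨q, -, rfl⟩
      · exact he
      · exact hc j
      · exact ((hc _).pow _).fun_sub ((hc _).pow _))
    ((continuous_fst.tendsto (0 : (Fin n → K) × K)).comp hb)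
  obtain ⟨ε, e', he', he'0, hee⟩ := (hS e (by simp)).resolve_left hne
  have hcj : ∀ j < m, (¬ ∀ᶠ z in 𝓝 0, c j z = 0) → IsMonomialUnit fun z => c j (π z) := by
    intro j hj
    refine (hS (c j) ?_).resolve_left
    simp only [Finset.mem_insert, Finset.mem_union, Finset.mem_image, Finset.mem_range]
    exact Or.inr (Or.inl ⟨j, hj, rfl⟩)
  choose! α w hw hw0 hwe using hcj
  set J := (Finset.range m).filter fun j => ¬ ∀ᶠ z in 𝓝 0, c j z = 0 with hJ
  have hJm : ∀ {j}, j ∈ J → j < m := fun hj => Finset.mem_range.1 (Finset.mem_filter.1 hj).1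
  have hJz : ∀ {j}, j ∈ J → ¬ ∀ᶠ z in 𝓝 0, c j z = 0 := fun hj => (Finset.mem_filter.1 hj).2
  have hJn : ∀ {j}, j < m → j ∉ J → ∀ᶠ z in 𝓝 0, c j z = 0 := fun hj hjJ => by
    by_contra h
    exact hjJ (Finset.mem_filter.2 ⟨Finset.mem_range.2 hj, h⟩)
  let δ : ℕ → Fin n → ℕ := fun j => (N / (m + 1 - j)) • α j
  have hchain : ∀ j ∈ J, ∀ k ∈ J, δ j ≤ δ k ∨ δ k ≤ δ j := by
    intro j hj k hk
    refine le_or_le_of_sub_isMonomialUnit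
      (f := fun z => c j (π z) ^ (N / (m + 1 - j))) (g := fun z => c k (π z) ^ (N / (m + 1 - k)))
      (u := fun z => w j z ^ (N / (m + 1 - j))) (v := fun z => w k z ^ (N / (m + 1 - k)))
      ((hw j (hJm hj) (hJz hj)).pow _) (pow_ne_zero _ (hw0 j (hJm hj) (hJz hj)))
      ((hw k (hJm hk) (hJz hk)).pow _) (pow_ne_zero _ (hw0 k (hJm hk) (hJz hk))) ?_ ?_ ?_
    · filter_upwards [hwe j (hJm hj) (hJz hj)] with z hz
      rw [hz, mul_pow, coordMonomial_smul]
    · filter_upwards [hwe k (hJm hk) (hJz hk)] with z hz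
      rw [hz, mul_pow, coordMonomial_smul]
    · refine (hS (dif (j, k)) ?_).imp_left fun h => hπ.tendsto_zero.eventually h
      simp only [Finset.mem_insert, Finset.mem_union, Finset.mem_image, Finset.mem_product,
        Finset.mem_range]
      exact Or.inr (Or.inr ⟨(j, k), ⟨hJm hj, hJm hk⟩, rfl⟩)
  obtain ⟨a, c₂, ha, hρ⟩ := exists_power_lift hN0 hπ.tendsto
  set ρ : (Fin n → K) → Fin n → K := fun z i => a i * z i ^ N with hρdef
  have hmonρ : ∀ α z, coordMonomial α (ρ z) = coordMonomial (N • α) z * coordMonomial α a :=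
    fun α z => coordMonomial_mul_pow α a z N
  have hπρ := hπ.comp hρ
  have ha' : ∀ α, coordMonomial α a ≠ 0 := fun α => coordMonomial_ne_zero fun i _ => ha i
  obtain ⟨c₃, hθ⟩ := hπρ.prodMap hb
  refine Uniformizes.of_lift hθ ?_
  have hfst : Tendsto (fun x : (Fin n → K) × K => x.1) (𝓝 0) (𝓝 0) := continuous_fst.tendsto 0
  set E : (Fin n → K) → K := fun z => coordMonomial ε a * e' (ρ z) with hE
  have hEa : AnalyticAt K E 0 := by
    exact analyticAt_const.fun_mul (he'.comp_zero hρ.analyticAt hρ.map_zero)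
  have hE0 : E 0 ≠ 0 := mul_ne_zero (ha' _) (by rwa [hρ.map_zero])
  have heE : ∀ᶠ x : (Fin n → K) × K in 𝓝 0, e (π (ρ x.1)) = coordMonomial (N • ε) x.1 * E x.1 := by
    filter_upwards [hfst.eventually (hρ.tendsto_zero.eventually hee)] with x hx
    rw [hx, hmonρ, mul_assoc]
  set U : (Fin n → K) × K → K := fun x => E x.1 * u (π (ρ x.1), x.2) with hU
  have hE1 : AnalyticAt K (fun x : (Fin n → K) × K => E x.1) 0 :=
    hEa.comp_zero (by fun_prop) rfl
  have hUa : AnalyticAt K U 0 := hE1.fun_mul (hu.comp_zero hθ.analyticAt hθ.map_zero)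
  have hU0 : U 0 ≠ 0 := mul_ne_zero hE0 (by
    have h1 : (π (ρ (0 : (Fin n → K) × K).1), (0 : (Fin n → K) × K).2) = 0 := hθ.map_zero
    rwa [h1])
  rcases J.eq_empty_or_nonempty with hJe | hJne
  · refine uniformizes_of_eventually_eq (α := N • ε) (m := m + 1) hθ.tendsto hUa hU0 ?_
    have hall : ∀ᶠ x : (Fin n → K) × K in 𝓝 0, ∀ j ∈ Finset.range m, c j (π (ρ x.1)) = 0 :=
      (Finset.eventually_all _).2 fun j hj => hfst.eventually
        (hπρ.tendsto_zero.eventually (hJn (Finset.mem_range.1 hj) (by simp [hJe])))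
    filter_upwards [heE, hall] with x h1 h2
    rw [h1, Finset.sum_eq_zero fun j hj => by rw [h2 j hj, zero_mul]]
    ring
  · obtain ⟨j₀, hj₀, hmin⟩ := J.exists_minimalFor δ hJne
    have hle : ∀ j ∈ J, δ j₀ ≤ δ j := fun j hj =>
      (hchain j₀ hj₀ j hj).elim id fun h => hmin hj h
    let v : ℕ → (Fin n → K) → K := fun j => if j ∈ J then fun z => E z *
      (coordMonomial ((m + 1 - j) • (δ j - δ j₀)) z * (coordMonomial (α j) a * w j (ρ z))) else 0
    have hv : ∀ j, AnalyticAt K (v j) 0 := by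
      intro j
      by_cases hj : j ∈ J
      · simp only [v, if_pos hj]
        exact hEa.fun_mul ((analyticAt_coordMonomial _ _).fun_mul (analyticAt_const.fun_mul
          ((hw j (hJm hj) (hJz hj)).comp_zero hρ.analyticAt hρ.map_zero)))
      · simp only [v, if_neg hj]
        exact analyticAt_const
    refine (uniformizes_of_weighted Hm (δ j₀) (N • ε) (v := v) hUa hU0 hv ⟨j₀, hJm hj₀, ?_⟩
      hθ.tendsto).congr ?_
    · simp only [v, if_pos hj₀, tsub_self, smul_zero, coordMonomial_zero, one_mul, hρ.map_zero]
      exact mul_ne_zero hE0 (mul_ne_zero (ha' _) (hw0 j₀ (hJm hj₀) (hJz hj₀)))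
    · have hall : ∀ᶠ x : (Fin n → K) × K in 𝓝 0, ∀ j ∈ Finset.range m,
          E x.1 * c j (π (ρ x.1)) = coordMonomial ((m + 1 - j) • δ j₀) x.1 * v j x.1 := by
        refine (Finset.eventually_all _).2 fun j hj => ?_
        have hjm := Finset.mem_range.1 hj
        by_cases hjJ : j ∈ J
        · filter_upwards [hfst.eventually (hρ.tendsto_zero.eventually (hwe j hjm (hJz hjJ)))]
            with x hx
          have h1 : N • α j = (m + 1 - j) • δ j₀ + (m + 1 - j) • (δ j - δ j₀) := by
            rw [← smul_add, add_tsub_cancel_of_le (hle j hjJ), smul_smul, ← hNdvd j hjm]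
          simp only [v, if_pos hjJ]
          rw [hx, hmonρ, h1, coordMonomial_add]
          ring
        · filter_upwards [hfst.eventually (hπρ.tendsto_zero.eventually (hJn hjm hjJ))] with x hx
          simp only [v, if_neg hjJ]
          rw [hx]
          simp
      filter_upwards [heE, hall] with x h1 h2
      rw [h1, mul_assoc]
      congr 1
      rw [mul_add, Finset.mul_sum]
      congr 1
      · refine Finset.sum_congr rfl fun j hj => ?_
        rw [← h2 j hj]
        ring
      · simp only [hU]
        ring

theorem UniformizationHolds.regular [ProperSpace K] [CharZero K] {n : ℕ}
    (H : UniformizationHolds K n) (d : ℕ) : RegularUniformizationHolds K n d := by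
  induction d with
  | zero => exact H.regular_zero
  | succ m ih =>
    intro h e b hh hord he hne hb
    by_cases hlt : analyticOrderAt (fun t : K => h (0, t)) 0 ≤ m
    · exact ih h e b hh hlt he hne hb
    have hord' : analyticOrderAt (fun t : K => h (0, t)) 0 = (m + 1 : ℕ) := by
      refine le_antisymm hord ?_
      push_cast
      exact Order.add_one_le_of_lt (not_le.1 hlt)
    obtain ⟨φ, c, u, hφ, hφ0, hc, hu, hu0, hφe⟩ := hh.exists_tschirnhaus hord'
    have hφ1 : AnalyticAt K (fun x : (Fin n → K) × K => φ x.1) 0 :=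
      hφ.comp_zero (by fun_prop) rfl
    have hb1 : Tendsto (fun k => (b k).1) atTop (𝓝 0) :=
      (continuous_fst.tendsto (0 : (Fin n → K) × K)).comp hb
    have hb2 : Tendsto (fun k => (b k).2) atTop (𝓝 0) :=
      (continuous_snd.tendsto (0 : (Fin n → K) × K)).comp hb
    have hlift : AnalyticLift K (fun x : (Fin n → K) × K => (x.1, φ x.1 + x.2)) b
        (fun k => ((b k).1, (b k).2 - φ (b k).1)) := by
      refine ⟨by fun_prop, by simp [hφ0], hb1.prodMk_nhds ?_, id, strictMono_id, fun k => by simp⟩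
      have h1 : Tendsto φ (𝓝 0) (𝓝 0) := by simpa only [hφ0] using hφ.continuousAt.tendsto
      simpa using hb2.sub (h1.comp hb1)
    refine Uniformizes.of_lift hlift ((H.of_expansion ih he hne hc hu hu0 hlift.tendsto).congr ?_)
    filter_upwards [hφe] with x hx
    rw [hx]

end Induction

section AllDimensions
variable {K : Type*} [NontriviallyNormedField K]

theorem AnalyticAt.exists_line_not_eventually_eq_zero {E : Type*} [NormedAddCommGroup E]
    [NormedSpace K E] [Nontrivial E] {f : E → K} (hf : AnalyticAt K f 0)
    (h : ¬ ∀ᶠ x in 𝓝 0, f x = 0) : ∃ v : E, v ≠ 0 ∧ ¬ ∀ᶠ s : K in 𝓝 0, f (s • v) = 0 := by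
  obtain ⟨p, hp⟩ := id hf
  by_contra! hcon
  have hk : ∀ v k, v ≠ 0 → p k (fun _ => v) = 0 := fun v k hv =>
    hp.apply_eq_zero_of_eventually_line (by simpa using hcon v hv) k
  refine h ?_
  have h0 : f 0 = 0 := by
    obtain ⟨v, hv⟩ := exists_ne (0 : E)
    simpa using (hcon v hv).self_of_nhds
  filter_upwards [hp.eventually_hasSum] with x hx
  by_cases hx0 : x = 0
  · rw [hx0, h0]
  · simp only [hk x _ hx0, zero_add] at hx
    exact hx.unique hasSum_zero

/-- Local uniformization along sequences: every nonzero analytic germ over a locally compact field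
of characteristic zero becomes a monomial times a unit after an analytic lift of a subsequence of
any given sequence tending to the origin. -/
theorem uniformizationHolds [ProperSpace K] [CharZero K] (n : ℕ) : UniformizationHolds K n := by
  induction n with
  | zero =>
    intro f hf hne b hb
    refine ⟨id, b, ⟨analyticAt_id, rfl, hb, id, strictMono_id, fun _ => rfl⟩,
      isMonomialUnit_of_ne_zero hf fun h0 => hne (Eventually.of_forall fun z => ?_)⟩
    exact (congrArg f (Subsingleton.elim z 0)).trans h0
  | succ n ih =>
    intro f hf hne b hb
    obtain ⟨v, hv, hfv⟩ := hf.exists_line_not_eventually_eq_zero hne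
    obtain ⟨i, hi⟩ := Function.ne_iff.1 hv
    simp only [Pi.zero_apply] at hi
    set π : (Fin n → K) × K → Fin (n + 1) → K := fun x => i.insertNth 0 x.1 + x.2 • v with hπdef
    have hπ : AnalyticLift K π b (fun k => ((fun j => b k (i.succAbove j) -
        b k i / v i * v (i.succAbove j) : Fin n → K), b k i / v i)) := by
      have hbi : ∀ j, Tendsto (fun k => b k j) atTop (𝓝 0) := fun j => tendsto_pi_nhds.1 hb j
      refine ⟨?_, ?_, Tendsto.prodMk_nhds (tendsto_pi_nhds.2 fun j => ?_) ?_, id, strictMono_id,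
        fun k => ?_⟩
      · refine AnalyticAt.pi fun j => ?_
        refine Fin.succAboveCases i ?_ (fun j => ?_) j
        · simp only [Pi.add_apply, Fin.insertNth_apply_same, Pi.smul_apply]
          fun_prop
        · simp only [Pi.add_apply, Fin.insertNth_apply_succAbove, Pi.smul_apply]
          fun_prop
      · funext j
        refine Fin.succAboveCases i ?_ (fun j => ?_) j <;> simp [hπdef]
      · simpa using (hbi (i.succAbove j)).sub (((hbi i).div_const (v i)).mul_const (v (i.succAbove j)))
      · simpa using (hbi i).div_const (v i)
      · funext j
        refine Fin.succAboveCases i ?_ (fun j => ?_) j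
        · simp [hπdef, hi]
        · simp [hπdef]
    refine Uniformizes.of_lift hπ ?_
    have hh : AnalyticAt K (fun x => f (π x)) 0 := hf.comp_zero hπ.analyticAt hπ.map_zero
    have hline : ∀ t : K, π (0, t) = t • v := by
      intro t
      funext j
      refine Fin.succAboveCases i ?_ (fun j => ?_) j <;> simp [hπdef]
    have htop : analyticOrderAt (fun t : K => f (π (0, t))) 0 ≠ ⊤ := by
      simp only [hline, ne_eq, analyticOrderAt_eq_top]
      exact hfv
    obtain ⟨d, hd⟩ := ENat.ne_top_iff_exists.1 htop
    refine (ih.regular d (fun x => f (π x)) (fun _ => 1) _ hh hd.ge analyticAt_const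
      (fun h1 => one_ne_zero h1.self_of_nhds) hπ.tendsto).congr ?_
    simp only [one_mul]
    rfl

end AllDimensions

section Padic
variable {p : ℕ} [Fact p.Prime] {n : ℕ}

theorem exists_measure_closedBall_le_pow_mul [MeasurableSpace (Fin n → ℚ_[p])]
    [BorelSpace (Fin n → ℚ_[p])] (μ : Measure (Fin n → ℚ_[p])) [μ.IsAddHaarMeasure] :
    ∃ Λ : ℕ, ∀ (m : ℕ) (x : Fin n → ℚ_[p]), μ (Metric.closedBall 0 1) ≤
      (Λ : ENNReal) ^ m * μ (Metric.closedBall x ((p : ℝ)⁻¹ ^ m)) := by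
  have hp0 : (0 : ℝ) < (p : ℝ)⁻¹ := by
    have := (Fact.out : p.Prime).pos
    positivity
  have hpK : (p : ℚ_[p]) ≠ 0 := by exact_mod_cast (Fact.out : p.Prime).ne_zero
  obtain ⟨T, -, hTf, hT⟩ := (isCompact_closedBall (0 : Fin n → ℚ_[p]) 1).finite_cover_balls hp0
  have hball : ∀ (m : ℕ) (x : Fin n → ℚ_[p]), μ (Metric.closedBall x ((p : ℝ)⁻¹ ^ m)) =
      μ (Metric.closedBall 0 ((p : ℝ)⁻¹ ^ m)) := by
    intro m x
    rw [← measure_preimage_add μ x (Metric.closedBall x ((p : ℝ)⁻¹ ^ m))]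
    congr 1
    ext y
    simp [dist_eq_norm]
  refine ⟨hTf.toFinset.card, fun m x => ?_⟩
  rw [hball m x]
  induction m with
  | zero => simp
  | succ m ih =>
    refine ih.trans ?_
    rw [pow_succ, mul_assoc]
    gcongr
    have hsub : Metric.closedBall (0 : Fin n → ℚ_[p]) ((p : ℝ)⁻¹ ^ m) ⊆
        ⋃ t ∈ hTf.toFinset, Metric.closedBall ((p : ℚ_[p]) ^ m • t) ((p : ℝ)⁻¹ ^ (m + 1)) := by
      intro y hy
      have hpm : (p : ℚ_[p]) ^ m ≠ 0 := pow_ne_zero _ hpK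
      set w := ((p : ℚ_[p]) ^ m)⁻¹ • y with hw
      have hyw : y = (p : ℚ_[p]) ^ m • w := by rw [hw, smul_inv_smul₀ hpm]
      have hw1 : w ∈ Metric.closedBall (0 : Fin n → ℚ_[p]) 1 := by
        rw [mem_closedBall_zero_iff] at hy ⊢
        rw [hyw, norm_smul, norm_pow, Padic.norm_p] at hy
        exact le_of_mul_le_mul_left (by simpa using hy) (pow_pos hp0 m)
      obtain ⟨t, ht, hwt⟩ := Set.mem_iUnion₂.1 (hT hw1)
      refine Set.mem_iUnion₂.2 ⟨t, hTf.mem_toFinset.2 ht, ?_⟩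
      rw [Metric.mem_ball, dist_eq_norm] at hwt
      rw [Metric.mem_closedBall, dist_eq_norm, hyw, ← smul_sub, norm_smul, norm_pow, Padic.norm_p,
        pow_succ]
      gcongr
    refine (measure_mono hsub).trans ((measure_biUnion_finset_le _ _).trans ?_)
    simp only [hball, Finset.sum_const, nsmul_eq_mul]
    exact le_rfl

/-- If `f / g` tends to `0` along a sequence tending to `a`, then arbitrarily close to `a` there is
a sequence along which `f` decays strictly faster than `g`, both geometrically. -/
theorem exists_geometric_decay {f g : (Fin n → ℚ_[p]) → ℚ_[p]} {a : Fin n → ℚ_[p]}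
    (hf : AnalyticAt ℚ_[p] f a) (hg : AnalyticAt ℚ_[p] g a) {b : ℕ → Fin n → ℚ_[p]}
    (hb : Tendsto b atTop (𝓝 a)) (hfg : ∀ k, f (b k) * g (b k) ≠ 0)
    (hlim : Tendsto (fun k => f (b k) / g (b k)) atTop (𝓝 0)) :
    ∃ α β : ℕ, β < α ∧ ∀ W ∈ 𝓝 a, ∃ (C C' : ℝ) (x : ℕ → Fin n → ℚ_[p]), 0 < C ∧ 0 < C' ∧
      ∀ j, x j ∈ W ∧ ‖f (x j)‖ = C * ((p : ℝ)⁻¹ ^ j) ^ α ∧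
        ‖g (x j)‖ = C' * ((p : ℝ)⁻¹ ^ j) ^ β := by
  have hshift : AnalyticAt ℚ_[p] (fun z : Fin n → ℚ_[p] => a + z) 0 := by fun_prop
  have hf' : AnalyticAt ℚ_[p] (fun z => f (a + z)) 0 :=
    AnalyticAt.fun_comp (by rwa [add_zero]) hshift
  have hg' : AnalyticAt ℚ_[p] (fun z => g (a + z)) 0 :=
    AnalyticAt.fun_comp (by rwa [add_zero]) hshift
  have hb' : Tendsto (fun k => b k - a) atTop (𝓝 0) := by simpa using hb.sub_const a
  obtain ⟨π, c, hπ, hNF⟩ := uniformizationHolds n (fun z => f (a + z) * g (a + z))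
    (hf'.fun_mul hg') (fun h => by
      obtain ⟨k, hk⟩ := (hb'.eventually h).exists
      exact hfg k (by simpa using hk)) _ hb'
  obtain ⟨φ, hφ, hφb⟩ := hπ.exists_subseq
  have hcb : ∀ k, a + π (c k) = b (φ k) := fun k => by rw [hφb, add_sub_cancel]
  have hf1 := hf'.comp_zero hπ.analyticAt hπ.map_zero
  have hg1 := hg'.comp_zero hπ.analyticAt hπ.map_zero
  obtain ⟨α, u, hu, hu0, hfe⟩ := IsMonomialUnit.of_mul_left hf1 hg1 hNF
  obtain ⟨β, v, hv, hv0, hge⟩ := IsMonomialUnit.of_mul_left hg1 hf1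
    (by simpa only [mul_comm] using hNF)
  obtain ⟨i, hi⟩ : ∃ i, β i < α i := by
    by_contra! hcon
    have h1 : Tendsto (fun k => u (c k)) atTop (𝓝 (u 0)) := hu.continuousAt.tendsto.comp hπ.tendsto
    have h2 : Tendsto (fun k => f (b (φ k)) / g (b (φ k)) *
        (coordMonomial (β - α) (c k) * v (c k))) atTop
        (𝓝 (0 * (coordMonomial (β - α) (0 : Fin n → ℚ_[p]) * v 0))) :=
      (hlim.comp hφ.tendsto_atTop).mul
        (((analyticAt_coordMonomial _ _).continuousAt.tendsto.comp hπ.tendsto).mul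
          (hv.continuousAt.tendsto.comp hπ.tendsto))
    rw [zero_mul] at h2
    refine hu0 (tendsto_nhds_unique (h1.congr' ?_) h2)
    filter_upwards [hπ.tendsto.eventually hfe, hπ.tendsto.eventually hge] with k hk1 hk2
    rw [hcb] at hk1 hk2
    have hne := hfg (φ k)
    have hf0 : f (b (φ k)) ≠ 0 := left_ne_zero_of_mul hne
    have hg0 : g (b (φ k)) ≠ 0 := right_ne_zero_of_mul hne
    have hm : coordMonomial α (c k) ≠ 0 := fun h => hf0 (by rw [hk1, h, zero_mul])
    have hβ : coordMonomial β (c k) = coordMonomial α (c k) * coordMonomial (β - α) (c k) := by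
      rw [← coordMonomial_add, add_tsub_cancel_of_le (Pi.le_def.2 hcon)]
    rw [hβ] at hk2
    rw [div_mul_eq_mul_div, eq_div_iff hg0, hk2, hk1]
    ring
  refine ⟨α i, β i, hi, fun W hW => ?_⟩
  have hnorm : ∀ {w : (Fin n → ℚ_[p]) → ℚ_[p]}, AnalyticAt ℚ_[p] w 0 → w 0 ≠ 0 →
      ∀ᶠ z in 𝓝 0, ‖w z‖ = ‖w 0‖ := by
    intro w hw hw0
    filter_upwards [hw.continuousAt.eventually (Metric.ball_mem_nhds _ (norm_pos_iff.2 hw0))]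
      with z hz
    exact Padic.norm_eq_of_norm_sub_lt_right (by simpa [dist_eq_norm] using hz)
  have hW' : ∀ᶠ z in 𝓝 0, a + π z ∈ W := by
    have : Tendsto (fun z => a + π z) (𝓝 0) (𝓝 (a + 0)) := hπ.tendsto_zero.const_add a
    rw [add_zero] at this
    exact this.eventually hW
  obtain ⟨δ, hδ, hball⟩ := Metric.eventually_nhds_iff_ball.1
    (hfe.and (hge.and ((hnorm hu hu0).and ((hnorm hv hv0).and hW'))))
  have hp0 : (0 : ℝ) < (p : ℝ)⁻¹ := by
    have := (Fact.out : p.Prime).pos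
    positivity
  have hp1 : (p : ℝ)⁻¹ < 1 := inv_lt_one_of_one_lt₀ (by exact_mod_cast (Fact.out : p.Prime).one_lt)
  have hpK : (p : ℚ_[p]) ≠ 0 := by exact_mod_cast (Fact.out : p.Prime).ne_zero
  obtain ⟨M, hM⟩ := exists_pow_lt_of_lt_one hδ hp1
  set ζ : Fin n → ℚ_[p] := fun _ => (p : ℚ_[p]) ^ M with hζ
  have hζ0 : ∀ γ, coordMonomial γ ζ ≠ 0 := fun γ => coordMonomial_ne_zero fun _ _ =>
    pow_ne_zero _ hpK
  let y : ℕ → Fin n → ℚ_[p] := fun j l => if l = i then (p : ℚ_[p]) ^ j * ζ l else ζ l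
  have hy : ∀ j, y j ∈ Metric.ball (0 : Fin n → ℚ_[p]) δ := by
    intro j
    rw [mem_ball_zero_iff, pi_norm_lt_iff hδ]
    intro l
    refine lt_of_le_of_lt ?_ hM
    simp only [y, hζ]
    split_ifs
    · rw [norm_mul, norm_pow, norm_pow, Padic.norm_p]
      exact mul_le_of_le_one_left (by positivity) (pow_le_one₀ hp0.le hp1.le)
    · rw [norm_pow, Padic.norm_p]
  refine ⟨‖coordMonomial α ζ‖ * ‖u 0‖, ‖coordMonomial β ζ‖ * ‖v 0‖, fun j => a + π (y j),
    mul_pos (norm_pos_iff.2 (hζ0 α)) (norm_pos_iff.2 hu0),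
    mul_pos (norm_pos_iff.2 (hζ0 β)) (norm_pos_iff.2 hv0), fun j => ?_⟩
  obtain ⟨h1, h2, h3, h4, h5⟩ := hball _ (hy j)
  refine ⟨h5, ?_, ?_⟩
  · change ‖(fun x => f (a + π x)) (y j)‖ = _
    rw [h1, norm_mul, h3, coordMonomial_ite_mul, norm_mul, norm_pow, norm_pow, Padic.norm_p]
    ring
  · change ‖(fun x => g (a + π x)) (y j)‖ = _
    rw [h2, norm_mul, h4, coordMonomial_ite_mul, norm_mul, norm_pow, norm_pow, Padic.norm_p]
    ring

theorem le_of_forall_mul_pow_le_mul_pow {A B s t : ℝ} (hA : 0 < A) (ht : 0 < t)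
    (h : ∀ j : ℕ, A * s ^ j ≤ B * t ^ j) : s ≤ t := by
  by_contra! hlt
  have h1 : 1 < s / t := (one_lt_div ht).2 hlt
  obtain ⟨j, hj⟩ := ((tendsto_pow_atTop_atTop_of_one_lt h1).eventually_gt_atTop (B / A)).exists
  rw [div_pow, div_lt_div_iff₀ hA (pow_pos ht j)] at hj
  have := h j
  linarith

end Padic

section Padic
variable {p : ℕ} [Fact p.Prime] {n : ℕ}

theorem IsUltrametricDist.closedBall_subset_closedBall {X : Type*} [PseudoMetricSpace X]
    [IsUltrametricDist X] {x y : X} {r s : ℝ} (hx : x ∈ Metric.closedBall y s) (hrs : r ≤ s) :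
    Metric.closedBall x r ⊆ Metric.closedBall y s := by
  rw [IsUltrametricDist.closedBall_eq_of_mem hx]
  exact Metric.closedBall_subset_closedBall hrs

/-- If `|f / g|` is bounded away from `0` on `W \ D`, all its nonpositive powers are integrable. -/
theorem integrableOn_rpow_of_le_norm [MeasurableSpace (Fin n → ℚ_[p])]
    [BorelSpace (Fin n → ℚ_[p])] {μ : Measure (Fin n → ℚ_[p])} {f g : (Fin n → ℚ_[p]) → ℚ_[p]}
    {E : Set (Fin n → ℚ_[p])} (hE : IsOpen E) (hμE : μ E ≠ ⊤) (hf : ContinuousOn f E)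
    (hg : ContinuousOn g E) (hfg : ∀ x ∈ E, f x * g x ≠ 0) {c : ℝ} (hc : 0 < c)
    (hle : ∀ x ∈ E, c ≤ ‖f x / g x‖) {σ : ℝ} (hσ : σ ≤ 0) :
    IntegrableOn (fun x => ‖f x / g x‖ ^ σ) E μ := by
  have hcont : ContinuousOn (fun x => ‖f x / g x‖ ^ σ) E := by
    refine ContinuousOn.rpow_const (hf.div hg fun x hx => right_ne_zero_of_mul (hfg x hx)).norm
      fun x hx => Or.inl (hc.trans_le (hle x hx)).ne'
  refine IntegrableOn.of_bound hμE.lt_top (hcont.aestronglyMeasurable hE.measurableSet) (c ^ σ) ?_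
  refine ae_restrict_of_forall_mem hE.measurableSet fun x hx => ?_
  rw [Real.norm_of_nonneg (by positivity)]
  exact Real.rpow_le_rpow_of_nonpos hc (hle x hx) hσ

theorem norm_eq_of_lipschitzOnWith {f : (Fin n → ℚ_[p]) → ℚ_[p]} {K : NNReal}
    {s : Set (Fin n → ℚ_[p])} (hf : LipschitzOnWith K f s) {x z : Fin n → ℚ_[p]} (hx : x ∈ s)
    (hz : z ∈ s) {r : ℝ} (hr : dist z x ≤ r) (h : K * r < ‖f x‖) : ‖f z‖ = ‖f x‖ := by
  refine Padic.norm_eq_of_norm_sub_lt_right (lt_of_le_of_lt ?_ h)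
  rw [← dist_eq_norm]
  exact (hf.dist_le_mul z hz x hx).trans (by gcongr)

theorem bddBelow_integrableOn_rpow [MeasurableSpace (Fin n → ℚ_[p])]
    [BorelSpace (Fin n → ℚ_[p])] (μ : Measure (Fin n → ℚ_[p])) [μ.IsAddHaarMeasure]
    {f g : (Fin n → ℚ_[p]) → ℚ_[p]} {a : Fin n → ℚ_[p]} {α β : ℕ} (hβα : β < α) {r : ℝ}
    (hr : 0 < r) {K : NNReal} (hfK : LipschitzOnWith K f (Metric.closedBall a r))
    (hgK : LipschitzOnWith K g (Metric.closedBall a r)) {C C' : ℝ} (hC : 0 < C) (hC' : 0 < C')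
    {x : ℕ → Fin n → ℚ_[p]} (hx : ∀ j, x j ∈ Metric.closedBall a r)
    (hfx : ∀ j, ‖f (x j)‖ = C * ((p : ℝ)⁻¹ ^ j) ^ α)
    (hgx : ∀ j, ‖g (x j)‖ = C' * ((p : ℝ)⁻¹ ^ j) ^ β)
    {E : Set (Fin n → ℚ_[p])}
    (hEs : ∀ z ∈ Metric.closedBall a r, f z * g z ≠ 0 → z ∈ E) :
    BddBelow {σ : ℝ | σ ≤ 0 ∧ IntegrableOn (fun z => ‖f z / g z‖ ^ σ) E μ} := by
  obtain ⟨Λ, hΛ⟩ := exists_measure_closedBall_le_pow_mul μ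
  have hq0 : (0 : ℝ) < (p : ℝ)⁻¹ := by
    have := (Fact.out : p.Prime).pos
    positivity
  have hq1 : (p : ℝ)⁻¹ < 1 := inv_lt_one_of_one_lt₀ (by exact_mod_cast (Fact.out : p.Prime).one_lt)
  set q : ℝ := (p : ℝ)⁻¹ with hq
  obtain ⟨m, hm⟩ := exists_pow_lt_of_lt_one (y := q)
    (show 0 < min (min C C' / (K + 1)) r by positivity) hq1
  obtain ⟨hmC, hmr⟩ := lt_min_iff.1 hm
  rw [lt_div_iff₀ (by positivity)] at hmC
  have hmK : K * q ^ m < min C C' := by nlinarith [pow_pos hq0 m]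
  have hμ0 : 0 < μ.real (Metric.closedBall 0 1) :=
    ENNReal.toReal_pos (Metric.measure_closedBall_pos μ _ one_pos).ne'
      (isCompact_closedBall _ _).measure_ne_top
  have hΛr : ∀ (l : ℕ) (z : Fin n → ℚ_[p]), μ.real (Metric.closedBall 0 1) ≤
      (Λ : ℝ) ^ l * μ.real (Metric.closedBall z (q ^ l)) := by
    intro l z
    have := ENNReal.toReal_mono (ENNReal.mul_ne_top (by simp)
      (isCompact_closedBall _ _).measure_ne_top) (hΛ l z)
    simpa [Measure.real] using this
  have hΛ0 : (0 : ℝ) < Λ := by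
    rcases Nat.eq_zero_or_pos Λ with h | h
    · have := hΛr 1 0
      simp only [h, Nat.cast_zero, pow_one, zero_mul] at this
      exact absurd this hμ0.not_ge
    · exact_mod_cast h
  have hball : ∀ j, ∀ z ∈ Metric.closedBall (x j) (q ^ (m + j * α)),
      z ∈ E ∧ ‖f z / g z‖ = C / C' * (q ^ (α - β)) ^ j := by
    intro j z hz
    have hqj : (0 : ℝ) < q ^ j := pow_pos hq0 j
    have hza : z ∈ Metric.closedBall a r :=
      IsUltrametricDist.closedBall_subset_closedBall (hx j)
        ((pow_le_pow_of_le_one hq0.le hq1.le (Nat.le_add_right _ _)).trans hmr.le) hz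
    have hlt : ∀ {c : ℝ} {γ : ℕ}, min C C' ≤ c → γ ≤ α →
        K * q ^ (m + j * α) < c * (q ^ j) ^ γ := by
      intro c γ hc hγ
      rw [pow_add, pow_mul, ← mul_assoc]
      calc K * q ^ m * (q ^ j) ^ α < c * (q ^ j) ^ α := by
            gcongr
            exact hmK.trans_le hc
        _ ≤ c * (q ^ j) ^ γ := by
            have : 0 ≤ c := (le_min hC.le hC'.le).trans hc
            gcongr c * ?_
            exact pow_le_pow_of_le_one hqj.le (pow_le_one₀ hq0.le hq1.le) hγ
    have hfz : ‖f z‖ = C * (q ^ j) ^ α := by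
      rw [← hfx j]
      exact norm_eq_of_lipschitzOnWith hfK (hx j) hza hz
        (by rw [hfx j]; exact hlt (min_le_left _ _) le_rfl)
    have hgz : ‖g z‖ = C' * (q ^ j) ^ β := by
      rw [← hgx j]
      exact norm_eq_of_lipschitzOnWith hgK (hx j) hza hz
        (by rw [hgx j]; exact hlt (min_le_right _ _) hβα.le)
    refine ⟨hEs z hza (mul_ne_zero (norm_pos_iff.1 ?_) (norm_pos_iff.1 ?_)), ?_⟩
    · rw [hfz]; positivity
    · rw [hgz]; positivity
    · have hpow : (q ^ (α - β)) ^ j = (q ^ j) ^ α / (q ^ j) ^ β := by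
        rw [← pow_mul, mul_comm, pow_mul, pow_sub₀ _ hqj.ne' hβα.le, div_eq_mul_inv]
      rw [norm_div, hfz, hgz, mul_div_mul_comm, hpow]
  refine ⟨Real.log ((Λ : ℝ) ^ α) / Real.log (q ^ (α - β)), fun σ ⟨_, hσE⟩ => ?_⟩
  have hk0 : 0 < q ^ (α - β) := pow_pos hq0 _
  have hkσ : 0 < (q ^ (α - β)) ^ σ := Real.rpow_pos_of_pos hk0 σ
  have hlog : Real.log (q ^ (α - β)) < 0 :=
    Real.log_neg hk0 (pow_lt_one₀ hq0.le hq1 (Nat.sub_pos_of_lt hβα).ne')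
  have key : (q ^ (α - β)) ^ σ ≤ (Λ : ℝ) ^ α := by
    refine le_of_forall_mul_pow_le_mul_pow
      (A := (C / C') ^ σ * μ.real (Metric.closedBall 0 1))
      (B := (∫ z in E, ‖f z / g z‖ ^ σ ∂μ) * (Λ : ℝ) ^ m)
      (by positivity) (by positivity) fun j => ?_
    have h1 : ∫ z in Metric.closedBall (x j) (q ^ (m + j * α)), ‖f z / g z‖ ^ σ ∂μ ≤
        ∫ z in E, ‖f z / g z‖ ^ σ ∂μ :=
      setIntegral_mono_set hσE (ae_of_all _ fun z => by positivity)
        (LE.le.eventuallyLE fun z hz => (hball j z hz).1)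
    rw [setIntegral_congr_fun Metric.isClosed_closedBall.measurableSet
      (g := fun _ => (C / C' * (q ^ (α - β)) ^ j) ^ σ) fun z hz => by
        simp only [(hball j z hz).2], setIntegral_const, smul_eq_mul] at h1
    have h2 : (C / C' * (q ^ (α - β)) ^ j) ^ σ = (C / C') ^ σ * ((q ^ (α - β)) ^ σ) ^ j := by
      rw [Real.mul_rpow (by positivity) (by positivity), Real.rpow_pow_comm hk0.le]
    rw [h2] at h1
    calc (C / C') ^ σ * μ.real (Metric.closedBall 0 1) * ((q ^ (α - β)) ^ σ) ^ j
        ≤ (C / C') ^ σ * ((Λ : ℝ) ^ (m + j * α) *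
          μ.real (Metric.closedBall (x j) (q ^ (m + j * α)))) * ((q ^ (α - β)) ^ σ) ^ j := by
          gcongr
          exact hΛr _ _
      _ = (Λ : ℝ) ^ (m + j * α) * (μ.real (Metric.closedBall (x j) (q ^ (m + j * α))) *
          ((C / C') ^ σ * ((q ^ (α - β)) ^ σ) ^ j)) := by ring
      _ ≤ (Λ : ℝ) ^ (m + j * α) * ∫ z in E, ‖f z / g z‖ ^ σ ∂μ := by gcongr
      _ = _ := by rw [pow_add, mul_comm j α, pow_mul]; ring
  have := Real.log_le_log hkσ key
  rw [Real.log_rpow hk0] at this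
  rwa [div_le_iff_of_neg hlog]

end Padic

end Auxiliary

/-- Criterion for the existence of a negative pole of the local zeta function of `f/g`:
the convergence set of exponents `σ ≤ 0` is bounded below for some compact open `W`
iff `|f/g|_p` tends to `0` along some bounded sequence. -/
theorem padic_zeta_negative_pole_criterion
    (p : ℕ) [Fact p.Prime] (n : ℕ)
    [MeasurableSpace (Fin n → ℚ_[p])] [BorelSpace (Fin n → ℚ_[p])]
    (μ : Measure (Fin n → ℚ_[p])) [μ.IsAddHaarMeasure]
    (hμ : μ (Set.univ.pi fun _ : Fin n => {x : ℚ_[p] | ‖x‖ ≤ 1}) = 1)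
    (U : Set (Fin n → ℚ_[p])) (hUopen : IsOpen U) (hUne : U.Nonempty)
    (f g : (Fin n → ℚ_[p]) → ℚ_[p])
    (hf : AnalyticOnNhd ℚ_[p] f U) (hg : AnalyticOnNhd ℚ_[p] g U)
    (hf0 : ∃ x ∈ U, f x ≠ 0) (hg0 : ∃ x ∈ U, g x ≠ 0)
    (hfg : ∀ c : ℚ_[p], ∃ x ∈ U, f x ≠ c * g x)
    (D : Set (Fin n → ℚ_[p])) (hD : D = {x ∈ U | f x * g x = 0}) :
    (∃ W : Set (Fin n → ℚ_[p]), W.Nonempty ∧ IsCompact W ∧ IsOpen W ∧ W ⊆ U ∧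
        BddBelow {σ : ℝ | σ ≤ 0 ∧
          IntegrableOn (fun x => ‖f x / g x‖ ^ σ) (W \ D) μ}) ↔
    (∃ (A : Set (Fin n → ℚ_[p])) (a : ℕ → (Fin n → ℚ_[p])),
        IsCompact A ∧ A ⊆ U ∧ (∀ k, a k ∈ A \ D) ∧
        Filter.Tendsto (fun k => ‖f (a k) / g (a k)‖) Filter.atTop (nhds 0)) := by
  have hne : ∀ x ∈ U, x ∉ D ↔ f x * g x ≠ 0 := fun x hx => by simp [hD, hx]
  have hopen : ∀ W ⊆ U, IsOpen W → IsOpen (W \ D) := by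
    intro W hWU hW
    have : W \ D = W ∩ (fun x => f x * g x) ⁻¹' {0}ᶜ := by
      ext x
      exact and_congr_right fun hx => hne x (hWU hx)
    rw [this]
    exact ((hf.continuousOn.mul hg.continuousOn).mono hWU).isOpen_inter_preimage hW
      isOpen_compl_singleton
  constructor
  · rintro ⟨W, -, hWc, hWo, hWU, hbdd⟩
    have hsmall : ∀ c : ℝ, 0 < c → ∃ x ∈ W \ D, ‖f x / g x‖ < c := by
      intro c hc
      by_contra! hcon
      obtain ⟨B, hB⟩ := hbdd
      have hmem : min B 0 - 1 ≤ 0 := by linarith [min_le_right B 0]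
      have := hB ⟨hmem, integrableOn_rpow_of_le_norm (hopen W hWU hWo)
        (measure_ne_top_of_subset Set.sdiff_subset hWc.measure_ne_top)
        (hf.continuousOn.mono (Set.sdiff_subset.trans hWU))
        (hg.continuousOn.mono (Set.sdiff_subset.trans hWU))
        (fun x hx => (hne x (hWU hx.1)).1 hx.2) hc hcon hmem⟩
      linarith [min_le_left B 0]
    choose a ha hlt using fun k : ℕ => hsmall (1 / ((k : ℝ) + 1)) (by positivity)
    exact ⟨W, a, hWc, hWU, ha, squeeze_zero (fun _ => norm_nonneg _) (fun k => (hlt k).le)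
      tendsto_one_div_add_atTop_nhds_zero_nat⟩
  · rintro ⟨A, b, hA, hAU, hb, hlim⟩
    obtain ⟨a, haA, φ, hφ, hφa⟩ := hA.tendsto_subseq fun k => (hb k).1
    have haU := hAU haA
    obtain ⟨α, β, hβα, hdecay⟩ := exists_geometric_decay (hf a haU) (hg a haU) hφa
      (fun k => (hne _ (hAU (hb (φ k)).1)).1 (hb (φ k)).2)
      ((tendsto_zero_iff_norm_tendsto_zero.2 hlim).comp hφ.tendsto_atTop)
    obtain ⟨K, s, hs, hfK⟩ := (hf a haU).hasStrictFDerivAt.exists_lipschitzOnWith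
    obtain ⟨L, t, ht, hgL⟩ := (hg a haU).hasStrictFDerivAt.exists_lipschitzOnWith
    obtain ⟨r, hr, hsub⟩ := Metric.nhds_basis_closedBall.mem_iff.1
      (Filter.inter_mem (hUopen.mem_nhds haU) (Filter.inter_mem hs ht))
    obtain ⟨C, C', x, hC, hC', hx⟩ := hdecay _ (Metric.closedBall_mem_nhds a hr)
    have hWU : Metric.closedBall a r ⊆ U := fun z hz => (hsub hz).1
    have hWo : IsOpen (Metric.closedBall a r) := IsUltrametricDist.isOpen_closedBall a hr.ne'
    refine ⟨Metric.closedBall a r, ⟨a, Metric.mem_closedBall_self hr.le⟩,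
      isCompact_closedBall a r, hWo, hWU, ?_⟩
    exact bddBelow_integrableOn_rpow μ hβα hr
      ((hfK.mono fun z hz => (hsub hz).2.1).weaken (le_max_left K L))
      ((hgL.mono fun z hz => (hsub hz).2.2).weaken (le_max_right K L)) hC hC'
      (fun j => (hx j).1) (fun j => (hx j).2.1) (fun j => (hx j).2.2)
      fun z hz hz0 => ⟨hz, (hne z (hWU hz)).2 hz0⟩
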